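/- arXiv:1112.6197 — 2 statements merged into one kernel-verified Lean document; each statement's English description precedes it below -/
import Mathlib

section
/- Let U ∈ W^{1,2}(𝕋₁*; U(m)) (d = 1) be a weak solution of the Euler-Lagrange equation −U'' + U' U^{-1} U' + lower-order terms with real-analytic coefficients A_j ∈ C^ω(𝕋₁*; u(m)) and constant diagonal matrices G^j, as in equation (EuleroLagrange). Then U is real-analytic. -/
open scoped BigOperators
open MeasureTheory Matrix

attribute [local instance] Matrix.frobeniusNormedAddCommGroup Matrix.frobeniusNormedSpace

/-- The nonlinearity of the Marzari–Vanderbilt Euler–Lagrange equation in dimension one: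
`N = U'U⁻¹U' + [U'U⁻¹AU − A'U − AU'] + [−(U'+AU)G + UGU⁻¹(U'+AU)]`. -/
noncomputable def elNonlin {m : ℕ} (U A : ℝ → Matrix (Fin m) (Fin m) ℂ)
    (G : Matrix (Fin m) (Fin m) ℂ) (x : ℝ) : Matrix (Fin m) (Fin m) ℂ :=
  deriv U x * (U x)⁻¹ * deriv U x
    + (deriv U x * (U x)⁻¹ * A x * U x - deriv A x * U x - A x * deriv U x)
    + (-((deriv U x + A x * U x) * G) + U x * G * (U x)⁻¹ * (deriv U x + A x * U x))

section AnalyticODE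

open Filter Set unitInterval
open scoped Topology ContDiff

/-- A continuous solution curve of `w = w₀ + t • g (t, w)` with `g` analytic is analytic. -/
theorem analyticAt_of_eventually_eq_add_smul {F : Type*} [NormedAddCommGroup F] [NormedSpace ℝ F]
    [CompleteSpace F] {w : ℝ → F} {g : ℝ × F → F} (hw : ContinuousAt w 0)
    (hg : AnalyticAt ℝ g (0, w 0)) (h : ∀ᶠ t in 𝓝 0, w t = w 0 + t • g (t, w t)) :
    AnalyticAt ℝ w 0 := by
  set f : ℝ × F → F := fun p => p.2 - p.1 • g p with hf
  have hfan : AnalyticAt ℝ f (0, w 0) := analyticAt_snd.sub (analyticAt_fst.smul hg)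
  have hcd : ContDiffAt ℝ ω f (0, w 0) := hfan.contDiffAt
  have hinv : (fderiv ℝ f (0, w 0) ∘L .inr ℝ ℝ F) = ContinuousLinearMap.id ℝ F := by
    have h1 : HasFDerivAt (fun v : F => f (0, v)) (fderiv ℝ f (0, w 0) ∘L .inr ℝ ℝ F) (w 0) :=
      (hfan.differentiableAt.hasFDerivAt).comp (w 0) (hasFDerivAt_prodMk_right 0 (w 0))
    have h2 : HasFDerivAt (fun v : F => f (0, v)) (ContinuousLinearMap.id ℝ F) (w 0) := by
      simpa [hf, Function.id_def] using hasFDerivAt_id (𝕜 := ℝ) (w 0)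
    exact h1.unique h2
  have hi : (fderiv ℝ f (0, w 0) ∘L .inr ℝ ℝ F).IsInvertible := by
    rw [hinv]; exact ⟨.refl ℝ F, rfl⟩
  have hn : (ω : WithTop ℕ∞) ≠ 0 := by simp
  have hev := hcd.eventually_apply_eq_iff_implicitFunction hn hi
  have hcurve : Tendsto (fun t => (t, w t)) (𝓝 0) (𝓝 ((0 : ℝ), w 0)) :=
    continuousAt_id.prodMk hw
  have heq : hcd.implicitFunction hn hi =ᶠ[𝓝 0] w := by
    filter_upwards [hcurve.eventually hev, h] with t ht ht'
    refine ht.1 ?_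
    simp only [hf, zero_smul, sub_zero]
    exact sub_eq_of_eq_add ht'
  have := hcd.contDiffAt_implicitFunction hn hi
  exact (this.analyticAt).congr heq

/-- Integration from the left endpoint, as an operator on continuous functions on `[0, 1]`. -/
noncomputable def primitiveCLM (E : Type*) [NormedAddCommGroup E] [NormedSpace ℝ E] :
    C(I, E) →L[ℝ] C(I, E) :=
  LinearMap.mkContinuous
    { toFun := fun v =>
        ⟨fun s => ∫ τ in (0 : ℝ)..s, IccExtend zero_le_one v τ, by
          have hc : Continuous (IccExtend (zero_le_one' ℝ) v) := v.continuous.Icc_extend'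
          exact (intervalIntegral.continuous_primitive
            (fun a b => hc.intervalIntegrable a b) 0).comp continuous_subtype_val⟩
      map_add' := fun u v => by
        ext s
        exact intervalIntegral.integral_add
          (Continuous.intervalIntegrable u.continuous.Icc_extend' _ _)
          (Continuous.intervalIntegrable v.continuous.Icc_extend' _ _)
      map_smul' := fun c v => by
        ext s
        exact intervalIntegral.integral_smul c _ }
    1 fun v => by
      rw [one_mul, ContinuousMap.norm_le _ (norm_nonneg v)]
      intro s
      refine (intervalIntegral.norm_integral_le_of_norm_le_const (C := ‖v‖)
        fun τ _ => v.norm_coe_le_norm _).trans ?_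
      rw [sub_zero, abs_of_nonneg s.2.1]
      exact mul_le_of_le_one_right (norm_nonneg v) s.2.2

/-- The function `s ↦ f (t₀ + t * s)` on `[0, 1]`. -/
def rescale {E : Type*} [TopologicalSpace E] (f : ℝ → E) (hf : Continuous f) (t₀ t : ℝ) :
    C(I, E) :=
  ⟨fun s => f (t₀ + t * s), by fun_prop⟩

theorem continuous_rescale {E : Type*} [TopologicalSpace E] {f : ℝ → E} (hf : Continuous f)
    (t₀ : ℝ) : Continuous (rescale f hf t₀) :=
  ContinuousMap.continuous_of_continuous_uncurry _ (by
    simp only [rescale, Function.uncurry_def, ContinuousMap.coe_mk]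
    fun_prop)

theorem rescale_eq_add_smul_primitiveCLM {E : Type*} [NormedAddCommGroup E] [NormedSpace ℝ E]
    [CompleteSpace E] {f f' : ℝ → E} (hf : Continuous f) (hf' : Continuous f')
    (h : ∀ x, HasDerivAt f (f' x) x) (t₀ t : ℝ) :
    rescale f hf t₀ t = rescale f hf t₀ 0 + t • primitiveCLM E (rescale f' hf' t₀ t) := by
  ext s
  have hd : ∀ τ : ℝ, HasDerivAt (fun τ => f (t₀ + t * τ)) (t • f' (t₀ + t * τ)) τ := fun τ => by
    have := (h (t₀ + t * τ)).scomp τ (((hasDerivAt_id τ).const_mul t).const_add t₀)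
    simpa [Function.comp_def] using this
  have hint := intervalIntegral.integral_eq_sub_of_hasDerivAt (a := 0) (b := (s : ℝ))
    (fun τ _ => hd τ) (Continuous.intervalIntegrable (by fun_prop) _ _)
  have hcongr : ∫ τ in (0 : ℝ)..s, IccExtend zero_le_one (rescale f' hf' t₀ t) τ
      = ∫ τ in (0 : ℝ)..s, f' (t₀ + t * τ) := by
    refine intervalIntegral.integral_congr fun τ hτ => ?_
    rw [uIcc_of_le s.2.1] at hτ
    exact IccExtend_of_mem _ _ ⟨hτ.1, hτ.2.trans s.2.2⟩
  rw [intervalIntegral.integral_smul] at hint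
  change f (t₀ + t * s) = f (t₀ + 0 * s)
    + t • ∫ τ in (0 : ℝ)..s, IccExtend zero_le_one (rescale f' hf' t₀ t) τ
  rw [hcongr, hint]
  simp

theorem analyticAt_rescale {E : Type*} [NormedAddCommGroup E] [NormedSpace ℝ E] [CompleteSpace E]
    {f : ℝ → E} (hf : Continuous f) {t₀ : ℝ} (h : AnalyticAt ℝ f t₀) :
    AnalyticAt ℝ (rescale f hf t₀) 0 := by
  obtain ⟨p, hp⟩ := h
  let c : ℕ → C(I, E) := fun n => ⟨fun s => (s : ℝ) ^ n • p.coeff n, by fun_prop⟩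
  have hc : ∀ n, ‖c n‖ ≤ ‖p.coeff n‖ := fun n => by
    rw [ContinuousMap.norm_le _ (norm_nonneg _)]
    intro s
    change ‖(s : ℝ) ^ n • p.coeff n‖ ≤ _
    rw [norm_smul, norm_pow, Real.norm_of_nonneg s.2.1]
    exact mul_le_of_le_one_left (norm_nonneg _) (pow_le_one₀ s.2.1 s.2.2)
  let q : FormalMultilinearSeries ℝ ℝ C(I, E) :=
    fun n => ContinuousMultilinearMap.mkPiRing ℝ (Fin n) (c n)
  have hq : ∀ n, q.coeff n = c n := fun n => by
    simp [q, FormalMultilinearSeries.coeff]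
  refine ⟨q, hasFPowerSeriesAt_iff.2 ?_⟩
  simp only [hq]
  clear_value q
  have hsum := hasFPowerSeriesAt_iff.1 hp
  obtain ⟨r, hr, hrs⟩ := Metric.eventually_nhds_iff.1 hsum
  have hrad : ∀ᶠ z : ℝ in 𝓝 0, Summable fun n => ‖z ^ n • p.coeff n‖ := by
    have : ∀ᶠ z : ℝ in 𝓝 0, z ∈ Metric.eball (0 : ℝ) p.radius :=
      Metric.eball_mem_nhds 0 hp.radius_pos
    filter_upwards [this] with z hz
    simpa [FormalMultilinearSeries.apply_eq_pow_smul_coeff] using p.summable_norm_apply hz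
  filter_upwards [hrad, Metric.ball_mem_nhds 0 hr] with z hz hzr
  have hs : Summable fun n => z ^ n • c n := by
    refine Summable.of_norm_bounded hz fun n => ?_
    rw [norm_smul, norm_smul]
    gcongr
    exact hc n
  have hlim : ∑' n, z ^ n • c n = rescale f hf t₀ (0 + z) := by
    ext s
    have hzs : dist (z * s) 0 < r := by
      rw [Metric.mem_ball, dist_zero_right] at hzr
      rw [dist_zero_right, norm_mul]
      refine lt_of_le_of_lt (mul_le_of_le_one_right (norm_nonneg _) ?_) hzr
      rw [Real.norm_of_nonneg s.2.1]
      exact s.2.2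
    have h1 : HasSum (fun n => (z ^ n • c n) s) ((∑' n, z ^ n • c n) s) :=
      ContinuousMap.hasSum_apply hs.hasSum s
    have h2 : HasSum (fun n => (z ^ n • c n) s) (f (t₀ + z * s)) := by
      have h3 : (fun n => (z ^ n • c n) s) = fun n => (z * s) ^ n • p.coeff n := by
        funext n
        rw [mul_pow, mul_smul]
        rfl
      rw [h3]
      exact hrs hzs
    rw [zero_add]
    exact h1.unique h2
  rw [← hlim]
  exact hs.hasSum

/-- Analytic regularity for the second order equation `U'' = N(U, U', x)` in a Banach algebra,
where `W` is the inverse of `U`. -/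
theorem analyticAt_of_quadratic_ode {R : Type*} [NormedRing R] [NormedAlgebra ℝ R]
    [CompleteSpace R] {U W V a b : ℝ → R} (G : R) (hUW : ∀ x, U x * W x = 1)
    (hWU : ∀ x, W x * U x = 1) (hW : Continuous W) (hU : ∀ x, HasDerivAt U (V x) x)
    (hV : ∀ x, HasDerivAt V (V x * W x * V x
      + (V x * W x * a x * U x - b x * U x - a x * V x)
      + (-((V x + a x * U x) * G) + U x * G * W x * (V x + a x * U x))) x)
    (ha : ∀ x, AnalyticAt ℝ a x) (hb : ∀ x, AnalyticAt ℝ b x) (t₀ : ℝ) :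
    AnalyticAt ℝ U t₀ := by
  have hUc : Continuous U := continuous_iff_continuousAt.2 fun x => (hU x).continuousAt
  have hVc : Continuous V := continuous_iff_continuousAt.2 fun x => (hV x).continuousAt
  have hac : Continuous a := continuous_iff_continuousAt.2 fun x => (ha x).continuousAt
  have hbc : Continuous b := continuous_iff_continuousAt.2 fun x => (hb x).continuousAt
  set N : ℝ → R := fun x => V x * W x * V x
      + (V x * W x * a x * U x - b x * U x - a x * V x)
      + (-((V x + a x * U x) * G) + U x * G * W x * (V x + a x * U x)) with hN
  have hNc : Continuous N := by fun_prop
  let u := rescale U hUc t₀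
  let v := rescale V hVc t₀
  let α := rescale a hac t₀
  let β := rescale b hbc t₀
  let γ : C(I, R) := .const I G
  have hα : AnalyticAt ℝ α 0 := analyticAt_rescale hac (ha t₀)
  have hβ : AnalyticAt ℝ β 0 := analyticAt_rescale hbc (hb t₀)
  let η : ℝ × C(I, R) × C(I, R) → C(I, R) := fun p =>
    p.2.2 * Ring.inverse p.2.1 * p.2.2
      + (p.2.2 * Ring.inverse p.2.1 * α p.1 * p.2.1 - β p.1 * p.2.1 - α p.1 * p.2.2)
      + (-((p.2.2 + α p.1 * p.2.1) * γ)
        + p.2.1 * γ * Ring.inverse p.2.1 * (p.2.2 + α p.1 * p.2.1))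
  have hinv : ∀ t, Ring.inverse (u t) = rescale W hW t₀ t := fun t => by
    let z : C(I, R)ˣ := ⟨u t, rescale W hW t₀ t, ContinuousMap.ext fun s => hUW _,
      ContinuousMap.ext fun s => hWU _⟩
    exact Ring.inverse_unit z
  have hη : ∀ t, η (t, u t, v t) = rescale N hNc t₀ t := fun t => by
    simp only [η, hinv]
    rfl
  have hunit : IsUnit (u 0) := ⟨⟨u 0, rescale W hW t₀ 0, ContinuousMap.ext fun s => hUW _,
      ContinuousMap.ext fun s => hWU _⟩, rfl⟩
  have hηan : AnalyticAt ℝ η (0, u 0, v 0) := by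
    have hu : AnalyticAt ℝ (fun p : ℝ × C(I, R) × C(I, R) => p.2.1) (0, u 0, v 0) :=
      analyticAt_fst.comp_of_eq analyticAt_snd rfl
    have hv : AnalyticAt ℝ (fun p : ℝ × C(I, R) × C(I, R) => p.2.2) (0, u 0, v 0) :=
      analyticAt_snd.comp_of_eq analyticAt_snd rfl
    have h1 : AnalyticAt ℝ (fun p : ℝ × C(I, R) × C(I, R) => Ring.inverse p.2.1)
        (0, u 0, v 0) := by
      obtain ⟨z, hz⟩ := hunit
      have := analyticAt_inverse (𝕜 := ℝ) z
      rw [hz] at this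
      exact this.comp_of_eq hu rfl
    have h2 : AnalyticAt ℝ (fun p : ℝ × C(I, R) × C(I, R) => α p.1) (0, u 0, v 0) :=
      hα.comp_of_eq analyticAt_fst rfl
    have h3 : AnalyticAt ℝ (fun p : ℝ × C(I, R) × C(I, R) => β p.1) (0, u 0, v 0) :=
      hβ.comp_of_eq analyticAt_fst rfl
    have hγ : AnalyticAt ℝ (fun _ : ℝ × C(I, R) × C(I, R) => γ) (0, u 0, v 0) := analyticAt_const
    have h4 := hv.add (h2.mul hu)
    exact (((hv.mul h1).mul hv).add (((((hv.mul h1).mul h2).mul hu).sub (h3.mul hu)).sub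
      (h2.mul hv))).add ((h4.mul hγ).neg.add (((hu.mul hγ).mul h1).mul h4))
  have key : AnalyticAt ℝ (fun t => (u t, v t)) 0 := by
    refine analyticAt_of_eventually_eq_add_smul
      (g := fun p => (primitiveCLM R p.2.2, primitiveCLM R (η p)))
      ((continuous_rescale hUc t₀).prodMk (continuous_rescale hVc t₀)).continuousAt ?_ ?_
    · refine AnalyticAt.prod ?_ ?_
      · exact ((primitiveCLM R).analyticAt _).comp_of_eq
          (analyticAt_snd.comp_of_eq analyticAt_snd rfl) rfl
      · exact ((primitiveCLM R).analyticAt _).comp_of_eq hηan rfl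
    · refine Eventually.of_forall fun t => Prod.ext ?_ ?_
      · exact rescale_eq_add_smul_primitiveCLM hUc hVc hU t₀ t
      · change v t = v 0 + t • primitiveCLM R (η (t, u t, v t))
        rw [hη]
        exact rescale_eq_add_smul_primitiveCLM hVc hNc hV t₀ t
  have hend : AnalyticAt ℝ (fun t => U (t₀ + t)) 0 := by
    have := ((ContinuousMap.evalCLM ℝ (1 : I)).analyticAt (u 0)).comp_of_eq
      (analyticAt_fst.comp_of_eq key rfl) rfl
    refine this.congr (Eventually.of_forall fun t => ?_)
    change U (t₀ + t * ((1 : I) : ℝ)) = _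
    simp
  have := hend.comp_of_eq (f := fun x => x - t₀) (x := t₀)
    (analyticAt_id.sub analyticAt_const) (sub_self t₀)
  refine this.congr (Eventually.of_forall fun x => ?_)
  simp

end AnalyticODE

section WeakDerivative

open Filter Set
open scoped Topology ContDiff

theorem exists_tsupport_subset_Ioo {f : ℝ → ℝ} (hf : HasCompactSupport f) :
    ∃ M : ℝ, 0 < M ∧ tsupport f ⊆ Ioo (-M) M := by
  obtain ⟨M, hM0, hM⟩ := hf.isBounded.subset_ball_lt 0 0
  refine ⟨M, hM0, fun x hx => ?_⟩
  have := hM hx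
  rwa [Real.ball_eq_Ioo, zero_sub, zero_add] at this

/-- A smooth compactly supported function of zero mean has a primitive of the same kind. -/
theorem exists_deriv_eq_of_integral_eq_zero {θ : ℝ → ℝ} (hθ : ContDiff ℝ ∞ θ)
    (hs : HasCompactSupport θ) (h0 : ∫ x, θ x = 0) :
    ∃ ψ : ℝ → ℝ, ContDiff ℝ ∞ ψ ∧ HasCompactSupport ψ ∧ deriv ψ = θ := by
  obtain ⟨M, hM0, hM⟩ := exists_tsupport_subset_Ioo hs
  have hout : ∀ x, x ∉ Ioo (-M) M → θ x = 0 := fun x hx =>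
    image_eq_zero_of_notMem_tsupport fun h => hx (hM h)
  have hderiv : deriv (fun x => ∫ t in (-M)..x, θ t) = θ :=
    funext fun x => hθ.continuous.deriv_integral θ (-M) x
  refine ⟨fun x => ∫ t in (-M)..x, θ t, ?_, ?_, hderiv⟩
  · refine contDiff_infty_iff_deriv.2 ⟨fun x => ?_, hderiv.symm ▸ hθ⟩
    exact (hθ.continuous.integral_hasStrictDerivAt (-M) x).hasDerivAt.differentiableAt
  · refine HasCompactSupport.intro (isCompact_Icc (a := -M) (b := M)) fun x hx => ?_
    rcases lt_or_ge x (-M) with h | h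
    · refine (intervalIntegral.integral_congr (g := fun _ => 0) fun t ht => ?_).trans (by simp)
      rw [uIcc_of_ge h.le] at ht
      exact hout t fun h' => absurd ht.2 (not_le.2 h'.1)
    · have hx' : M < x := by
        by_contra! h'
        exact hx ⟨h, h'⟩
      change ∫ t in (-M)..x, θ t = 0
      rw [intervalIntegral.integral_eq_integral_of_support_subset, h0]
      intro t ht
      have := hM (subset_tsupport _ ht)
      exact ⟨this.1, this.2.le.trans hx'.le⟩

/-- The du Bois-Reymond lemma on the real line. -/
theorem ae_eq_const_of_integral_deriv_mul_eq_zero {k : ℝ → ℝ} (hk : LocallyIntegrable k)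
    (h : ∀ ψ : ℝ → ℝ, ContDiff ℝ ∞ ψ → HasCompactSupport ψ → ∫ x, deriv ψ x * k x = 0) :
    ∃ c, ∀ᵐ x, k x = c := by
  let f : ContDiffBump (0 : ℝ) := ⟨1, 2, one_pos, one_lt_two⟩
  set ρ : ℝ → ℝ := f.normed volume with hρ
  have hρ1 : ∫ x, ρ x = 1 := f.integral_normed
  have hρs : HasCompactSupport ρ := f.hasCompactSupport_normed
  have hρc : ContDiff ℝ ∞ ρ := f.contDiff_normed
  have hint : ∀ {g : ℝ → ℝ}, ContDiff ℝ ∞ g → HasCompactSupport g →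
      Integrable fun x => g x * k x := fun hg hgs =>
    hk.integrable_smul_left_of_hasCompactSupport hg.continuous hgs
  have hint' : ∀ {g : ℝ → ℝ}, ContDiff ℝ ∞ g → HasCompactSupport g → Integrable g :=
    fun hg hgs => hg.continuous.integrable_of_hasCompactSupport hgs
  set c := ∫ x, ρ x * k x with hc
  refine ⟨c, ?_⟩
  suffices ∀ᵐ x, k x - c = 0 from this.mono fun x hx => sub_eq_zero.1 hx
  refine ae_eq_zero_of_integral_contDiff_smul_eq_zero (hk.sub (locallyIntegrable_const c))
    fun θ hθ hθs => ?_
  set S := ∫ x, θ x with hS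
  have hSρ : ContDiff ℝ ∞ fun x => S * ρ x := contDiff_const.mul hρc
  have hSρs : HasCompactSupport fun x => S * ρ x := hρs.mul_left
  obtain ⟨ψ, hψ, hψs, hψd⟩ := exists_deriv_eq_of_integral_eq_zero (hθ.sub hSρ) (hθs.sub hSρs) (by
    change ∫ x, θ x - S * ρ x = 0
    rw [integral_sub (hint' hθ hθs) (hint' hSρ hSρs), integral_const_mul, hρ1, mul_one, sub_self])
  have h1 := h ψ hψ hψs
  rw [hψd] at h1
  have h2 : ∫ x, (θ x * k x - S * (ρ x * k x)) = 0 := by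
    rw [← h1]
    congr 1
    funext x
    ring
  rw [integral_sub (hint hθ hθs) ((hint hρc hρs).const_mul S), integral_const_mul, ← hc] at h2
  simp only [smul_eq_mul, mul_sub]
  rw [integral_sub (hint hθ hθs) ((hint' hθ hθs).mul_const c), integral_mul_const, ← hS]
  exact h2

theorem integral_deriv_mul_primitive {n ψ : ℝ → ℝ} (hn : LocallyIntegrable n)
    (hψ : ContDiff ℝ ∞ ψ) (hs : HasCompactSupport ψ) :
    ∫ x, deriv ψ x * ∫ t in (0 : ℝ)..x, n t = -∫ x, ψ x * n x := by
  obtain ⟨M, hM0, hM⟩ := exists_tsupport_subset_Ioo hs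
  have hni : ∀ a b : ℝ, IntervalIntegrable n volume a b := fun a b =>
    (hn.integrableOn_isCompact isCompact_uIcc).intervalIntegrable
  have hsub : Function.support ψ ⊆ Ioc (-M) M :=
    (subset_tsupport ψ).trans (hM.trans Ioo_subset_Ioc_self)
  have hsub' : Function.support (deriv ψ) ⊆ Ioc (-M) M :=
    (support_deriv_subset).trans (hM.trans Ioo_subset_Ioc_self)
  have hψ0 : ∀ x, x ∉ Ioo (-M) M → ψ x = 0 := fun x hx =>
    image_eq_zero_of_notMem_tsupport fun h => hx (hM h)
  have hP : AbsolutelyContinuousOnInterval (fun x => ∫ t in (0 : ℝ)..x, n t) (-M) M :=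
    (hni (-M) M).absolutelyContinuousOnInterval_intervalIntegral (by
      rw [uIcc_of_le (by linarith)]; constructor <;> linarith)
  have hψa : AbsolutelyContinuousOnInterval ψ (-M) M :=
    (hψ.of_le (by simp)).contDiffOn.absolutelyContinuousOnInterval
  have key := hP.integral_mul_deriv_eq_deriv_mul hψa
  rw [hψ0 M (by simp), hψ0 (-M) (by simp), mul_zero, mul_zero, sub_zero, zero_sub] at key
  have hd : ∫ x in (-M)..M, deriv (fun x => ∫ t in (0 : ℝ)..x, n t) x * ψ x
      = ∫ x in (-M)..M, ψ x * n x := by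
    refine intervalIntegral.integral_congr_ae ?_
    filter_upwards [_root_.LocallyIntegrable.ae_hasDerivAt_integral hn] with x hx _
    rw [(hx 0).deriv, mul_comm]
  rw [hd, intervalIntegral.integral_eq_integral_of_support_subset,
    intervalIntegral.integral_eq_integral_of_support_subset] at key
  · rw [← key]
    simp only [mul_comm]
  · exact fun x hx => hsub (left_ne_zero_of_mul hx)
  · exact fun x hx => hsub' (right_ne_zero_of_mul hx)

/-- If `w` is differentiable with locally integrable derivative `d`, and `n` is the weak derivative
of `d`, then `d` is everywhere the primitive of `n`. -/
theorem eq_add_integral_of_weak_deriv {w d n : ℝ → ℝ} (hw : ∀ x, HasDerivAt w (d x) x)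
    (hd : LocallyIntegrable d) (hn : LocallyIntegrable n)
    (h : ∀ ψ : ℝ → ℝ, ContDiff ℝ ∞ ψ → HasCompactSupport ψ →
      ∫ x, (deriv ψ x * d x + ψ x * n x) = 0) (x : ℝ) :
    d x = d 0 + ∫ t in (0 : ℝ)..x, n t := by
  have hni : ∀ a b : ℝ, IntervalIntegrable n volume a b := fun a b =>
    (hn.integrableOn_isCompact isCompact_uIcc).intervalIntegrable
  have hPc : Continuous fun x => ∫ t in (0 : ℝ)..x, n t :=
    intervalIntegral.continuous_primitive hni 0
  obtain ⟨c, hc⟩ := ae_eq_const_of_integral_deriv_mul_eq_zero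
    (hd.sub hPc.locallyIntegrable) fun ψ hψ hψs => by
      have hψ' : Continuous (deriv ψ) := hψ.continuous_deriv (by simp)
      have i1 : Integrable fun x => deriv ψ x * d x :=
        hd.integrable_smul_left_of_hasCompactSupport hψ' hψs.deriv
      have i2 : Integrable fun x => ψ x * n x :=
        hn.integrable_smul_left_of_hasCompactSupport hψ.continuous hψs
      have i3 : Integrable fun x => deriv ψ x * ∫ t in (0 : ℝ)..x, n t :=
        hPc.locallyIntegrable.integrable_smul_left_of_hasCompactSupport hψ' hψs.deriv
      have h1 := h ψ hψ hψs
      rw [integral_add i1 i2] at h1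
      simp only [Pi.sub_apply, mul_sub]
      rw [integral_sub i1 i3, integral_deriv_mul_primitive hn hψ hψs]
      linarith
  have hde : ∀ᵐ x, d x = c + ∫ t in (0 : ℝ)..x, n t := hc.mono fun x hx => by
    simp only [Pi.sub_apply] at hx
    linarith
  have hgc : Continuous fun x => c + ∫ t in (0 : ℝ)..x, n t := continuous_const.add hPc
  have hall : ∀ x, d x = c + ∫ t in (0 : ℝ)..x, n t := fun x => by
    have hwe : w = fun x => w 0 + ∫ y in (0 : ℝ)..x, (c + ∫ t in (0 : ℝ)..y, n t) := by
      funext x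
      have h1 := intervalIntegral.integral_eq_sub_of_hasDerivAt (a := 0) (b := x)
        (fun y _ => hw y) (hd.integrableOn_isCompact isCompact_uIcc).intervalIntegrable
      rw [← intervalIntegral.integral_congr_ae (hde.mono fun y hy _ => hy), h1]
      ring
    have h2 := (hgc.integral_hasStrictDerivAt 0 x).hasDerivAt.const_add (w 0)
    rw [← hwe] at h2
    exact (hw x).unique h2
  rw [hall x, hall 0, intervalIntegral.integral_same, add_zero]

end WeakDerivative

section LocallyIntegrable

open Function Set
open scoped Topology

theorem Function.Periodic.locallyIntegrable {E : Type*} [NormedAddCommGroup E] {f : ℝ → E} {T : ℝ}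
    (hf : Periodic f T) (hT : 0 < T) (h : IntegrableOn f (Icc 0 T)) : LocallyIntegrable f :=
  locallyIntegrable_iff.2 fun k hk => by
    obtain ⟨r, hr⟩ := hk.isBounded.subset_closedBall 0
    rw [Real.closedBall_eq_Icc] at hr
    have hi := hf.intervalIntegrable₀ hT.ne'
      ((intervalIntegrable_iff_integrableOn_Icc_of_le hT.le).2 h) (0 - r) (0 + r)
    rcases le_total (0 - r) (0 + r) with h' | h'
    · exact ((intervalIntegrable_iff_integrableOn_Icc_of_le h').1 hi).mono_set hr
    · refine IntegrableOn.mono_set ?_ (hr.trans (Icc_subset_Icc_left h'))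
      simp

variable {R : Type*} [NormedRing R]

theorem locallyIntegrable_of_norm_sq {E : Type*} [NormedAddCommGroup E] {f : ℝ → E}
    (hf : AEStronglyMeasurable f) (h : LocallyIntegrable fun x => ‖f x‖ ^ 2) :
    LocallyIntegrable f := by
  refine (h.add (locallyIntegrable_const (1 : ℝ))).mono hf (Filter.Eventually.of_forall fun x => ?_)
  simp only [Pi.add_apply]
  rw [Real.norm_of_nonneg (by positivity)]
  nlinarith [sq_nonneg (‖f x‖ - 1)]

theorem locallyIntegrable_mul_mul_self {f g : ℝ → R} (hf : AEStronglyMeasurable f)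
    (hg : Continuous g) (h : LocallyIntegrable fun x => ‖f x‖ ^ 2) :
    LocallyIntegrable fun x => f x * g x * f x := by
  have hg' : AEStronglyMeasurable g := hg.aestronglyMeasurable
  refine (h.mul_continuous hg.norm).mono ((hf.mul hg').mul hf)
    (Filter.Eventually.of_forall fun x => ?_)
  rw [Real.norm_of_nonneg (by positivity)]
  calc ‖f x * g x * f x‖ ≤ ‖f x‖ * ‖g x‖ * ‖f x‖ :=
        (norm_mul_le _ _).trans (mul_le_mul_of_nonneg_right (norm_mul_le _ _) (norm_nonneg _))
    _ = ‖f x‖ ^ 2 * ‖g x‖ := by ring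

end LocallyIntegrable

section EulerLagrange

open Filter
open scoped ContDiff

variable {R ι : Type*} [NormedRing R] [NormedAlgebra ℝ R] [FiniteDimensional ℝ R]

/-- If a family `ℓ` of functionals separates points and `-U'' + N = 0` weakly when tested by each
`ℓ i`, then the equation holds in integrated form. -/
theorem deriv_eq_add_integral_of_weak {U N : ℝ → R} (ℓ : ι → R →ₗ[ℝ] ℝ)
    (hℓ : ∀ X Y, (∀ i, ℓ i X = ℓ i Y) → X = Y)
    (hU : Differentiable ℝ U) (hD : LocallyIntegrable (deriv U)) (hN : LocallyIntegrable N)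
    (hweak : ∀ i, ∀ ψ : ℝ → ℝ, ContDiff ℝ ∞ ψ → HasCompactSupport ψ →
      ∫ x, (deriv ψ x * ℓ i (deriv U x) + ψ x * ℓ i (N x)) = 0) (x : ℝ) :
    deriv U x = deriv U 0 + ∫ t in (0 : ℝ)..x, N t := by
  have := FiniteDimensional.complete ℝ R
  have hNi : IntervalIntegrable N volume 0 x :=
    (hN.integrableOn_isCompact isCompact_uIcc).intervalIntegrable
  refine hℓ _ _ fun i => ?_
  let L : R →L[ℝ] ℝ := LinearMap.toContinuousLinearMap (ℓ i)
  have hcomp : ∀ {f : ℝ → R}, LocallyIntegrable f → LocallyIntegrable fun x => L (f x) :=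
    fun hf => locallyIntegrable_iff.2 fun k hk => L.integrable_comp (hf.integrableOn_isCompact hk)
  change L _ = L _
  rw [map_add, ← L.intervalIntegral_comp_comm hNi]
  exact eq_add_integral_of_weak_deriv (w := fun x => L (U x)) (d := fun x => L (deriv U x))
    (fun y => L.hasFDerivAt.comp_hasDerivAt y (hU y).hasDerivAt) (hcomp hD) (hcomp hN)
    (hweak i) x

/-- Analytic regularity of weak solutions of the one-dimensional Euler–Lagrange equation, in a
finite-dimensional algebra; `W` is the inverse of `U`. -/
theorem analyticAt_of_weak_quadratic_ode {U W a b : ℝ → R} (G : R) (ℓ : ι → R →ₗ[ℝ] ℝ)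
    (hℓ : ∀ X Y, (∀ i, ℓ i X = ℓ i Y) → X = Y) (hUW : ∀ x, U x * W x = 1)
    (hWU : ∀ x, W x * U x = 1) (hW : Continuous W) (hU : Differentiable ℝ U)
    (hD2 : LocallyIntegrable fun x => ‖deriv U x‖ ^ 2)
    (ha : ∀ x, AnalyticAt ℝ a x) (hb : ∀ x, AnalyticAt ℝ b x)
    (hweak : ∀ i, ∀ ψ : ℝ → ℝ, ContDiff ℝ ∞ ψ → HasCompactSupport ψ →
      ∫ x, (deriv ψ x * ℓ i (deriv U x) + ψ x * ℓ i (deriv U x * W x * deriv U x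
        + (deriv U x * W x * a x * U x - b x * U x - a x * deriv U x)
        + (-((deriv U x + a x * U x) * G) + U x * G * W x * (deriv U x + a x * U x)))) = 0)
    (t₀ : ℝ) : AnalyticAt ℝ U t₀ := by
  have := FiniteDimensional.complete ℝ R
  have hUc := hU.continuous
  have hac : Continuous a := continuous_iff_continuousAt.2 fun x => (ha x).continuousAt
  have hbc : Continuous b := continuous_iff_continuousAt.2 fun x => (hb x).continuousAt
  have hDm : AEStronglyMeasurable (deriv U) := aestronglyMeasurable_deriv U _
  have hD : LocallyIntegrable (deriv U) := locallyIntegrable_of_norm_sq hDm hD2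
  have hDaU : LocallyIntegrable fun x => deriv U x + a x * U x :=
    hD.add (hac.mul hUc).locallyIntegrable
  have hN := ((locallyIntegrable_mul_mul_self hDm hW hD2).add
    ((((((hD.mul_continuous hW).mul_continuous hac).mul_continuous hUc).sub
      (hbc.mul hUc).locallyIntegrable)).sub (hD.continuous_mul hac))).add
    ((hDaU.mul_continuous (continuous_const (y := G))).neg.add
      (hDaU.continuous_mul ((hUc.mul (continuous_const (y := G))).mul hW)))
  have hint := deriv_eq_add_integral_of_weak ℓ hℓ hU hD hN hweak
  have hDc : Continuous (deriv U) := by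
    rw [funext hint]
    exact continuous_const.add (intervalIntegral.continuous_primitive
      (fun _ _ => (hN.integrableOn_isCompact isCompact_uIcc).intervalIntegrable) 0)
  refine analyticAt_of_quadratic_ode (V := deriv U) G hUW hWU hW (fun x => (hU x).hasDerivAt)
    (fun x => ?_) ha hb t₀
  have hNc : Continuous fun x => deriv U x * W x * deriv U x
      + (deriv U x * W x * a x * U x - b x * U x - a x * deriv U x)
      + (-((deriv U x + a x * U x) * G) + U x * G * W x * (deriv U x + a x * U x)) := by
    fun_prop
  have := (hNc.integral_hasStrictDerivAt 0 x).hasDerivAt.const_add (deriv U 0)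
  exact this.congr_of_eventuallyEq (Filter.Eventually.of_forall hint)

end EulerLagrange

theorem Function.Periodic.deriv {E : Type*} [NormedAddCommGroup E] [NormedSpace ℝ E]
    {f : ℝ → E} {T : ℝ} (hf : Function.Periodic f T) : Function.Periodic (deriv f) T := fun x => by
  rw [← deriv_comp_add_const, funext hf]

theorem Matrix.eq_of_forall_re_trace_eq {m : Type*} [Fintype m] {X Y : Matrix m m ℂ}
    (h : ∀ E : Matrix m m ℂ, (trace (Xᴴ * E)).re = (trace (Yᴴ * E)).re) : X = Y := by
  classical
  ext i j
  have h1 := h (Matrix.single i j 1)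
  have h2 := h (Matrix.single i j Complex.I)
  simp only [Matrix.trace_mul_single, conjTranspose_apply] at h1 h2
  refine Complex.ext ?_ ?_
  · simpa using h1
  · simpa using h2

/-- The real functional `X ↦ Re tr(Xᴴ E)` on complex matrices. -/
noncomputable def reTraceₗ {m : ℕ} (E : Matrix (Fin m) (Fin m) ℂ) :
    Matrix (Fin m) (Fin m) ℂ →ₗ[ℝ] ℝ where
  toFun X := (trace (Xᴴ * E)).re
  map_add' X Y := by simp [add_mul]
  map_smul' c X := by simp

/-- In dimension `d = 1`, any `W^{1,2}` weak solution of the Euler–Lagrange equation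
for the Marzari–Vanderbilt functional, with real-analytic periodic coefficients `A` and
constant purely imaginary diagonal matrix `G`, is real-analytic. -/
theorem one_dim_EL_analytic {m : ℕ} (hm : 1 ≤ m) (T : ℝ) (hT : 0 < T)
    (U A : ℝ → Matrix (Fin m) (Fin m) ℂ) (G : Matrix (Fin m) (Fin m) ℂ)
    -- U belongs to W^{1,2}(𝕋₁*; U(m)): periodic, differentiable with L² derivative
    (hUper : ∀ x, U (x + T) = U x)
    (hUunit : ∀ x, U x ∈ Matrix.unitaryGroup (Fin m) ℂ)
    (hUdiff : Differentiable ℝ U)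
    (hUL2 : IntegrableOn (fun x => ‖deriv U x‖ ^ 2) (Set.Icc 0 T) volume)
    -- the Berry connection coefficient A is real-analytic, periodic, u(m)-valued
    (hAan : AnalyticOnNhd ℝ A Set.univ)
    (hAper : ∀ x, A (x + T) = A x)
    (hAanti : ∀ x, (A x)ᴴ = -(A x))
    -- G is a constant purely imaginary diagonal matrix
    (hG : ∃ g : Fin m → ℂ, (∀ i, (g i).re = 0) ∧ G = Matrix.diagonal g)
    -- weak formulation of −U'' + N = 0: ∫ ⟨U', φ'⟩ + ⟨N, φ⟩ = 0 for all test φ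
    (hweak : ∀ φ : ℝ → Matrix (Fin m) (Fin m) ℂ, ContDiff ℝ (⊤ : ℕ∞) φ → HasCompactSupport φ →
      ∫ x : ℝ, ((Matrix.trace ((deriv U x)ᴴ * deriv φ x)).re
        + (Matrix.trace ((elNonlin U A G x)ᴴ * φ x)).re) = 0) :
    AnalyticOnNhd ℝ U Set.univ := by
  have hinv : ∀ x, (U x)⁻¹ = (U x)ᴴ := fun x =>
    Matrix.inv_eq_left_inv (Matrix.mem_unitaryGroup_iff'.1 (hUunit x))
  have hderiv : ∀ x, deriv U (x + T) = deriv U x := Function.Periodic.deriv hUper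
  have hper : Function.Periodic (fun x => ‖deriv U x‖ ^ 2) T := fun x => by
    simp only [hderiv]
  have hA : AnalyticOnNhd ℝ (deriv A) Set.univ := hAan.deriv
  let := Matrix.frobeniusNormedRing (m := Fin m) (α := ℂ)
  let : NormedAlgebra ℝ (Matrix (Fin m) (Fin m) ℂ) := Matrix.frobeniusNormedAlgebra
  refine fun t₀ _ => analyticAt_of_weak_quadratic_ode (W := fun x => (U x)ᴴ) (b := deriv A) G
    reTraceₗ (fun X Y => Matrix.eq_of_forall_re_trace_eq)
    (fun x => Matrix.mem_unitaryGroup_iff.1 (hUunit x))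
    (fun x => Matrix.mem_unitaryGroup_iff'.1 (hUunit x))
    hUdiff.continuous.matrix_conjTranspose hUdiff (hper.locallyIntegrable hT hUL2)
    (fun x => hAan x trivial) (fun x => hA x trivial) (fun E ψ hψ hψs => ?_) t₀
  have hφ := hweak (fun x => ψ x • E) (hψ.smul contDiff_const) hψs.smul_right
  rw [← hφ]
  congr 1
  funext y
  have hd : deriv (fun x => ψ x • E) y = deriv ψ y • E :=
    ((hψ.differentiable (by simp) y).hasDerivAt.smul_const E).deriv
  rw [hd]
  simp only [elNonlin, hinv, Matrix.mul_smul, Matrix.trace_smul, Complex.smul_re, smul_eq_mul]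
  rfl
end

section
/- Let U ∈ W^{1,2}_loc(ℝ³ \ {0}; U(m)) (m ≥ 2) be a degree-zero homogeneous weakly harmonic map, i.e. U(k) = ω(k/|k|). Then det U ≡ α for some constant α ∈ U(1), and there exists a constant unitary matrix U₀ such that U₀U takes values in SU(m); consequently tr(U* ∂_j U) ≡ 0 for each j. -/
open scoped BigOperators
open MeasureTheory Matrix

attribute [local instance] Matrix.frobeniusNormedAddCommGroup Matrix.frobeniusNormedSpace

/-- Partial derivative `∂_j` of a matrix-valued function on `ℝ³` (Euclidean). -/
noncomputable def empd3 {m : ℕ} (j : Fin 3)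
    (F : EuclideanSpace ℝ (Fin 3) → Matrix (Fin m) (Fin m) ℂ)
    (x : EuclideanSpace ℝ (Fin 3)) : Matrix (Fin m) (Fin m) ℂ :=
  fderiv ℝ F x (EuclideanSpace.single j 1)

open Filter Topology Convolution

section Mollification

variable {E : Type*} [NormedAddCommGroup E] [InnerProductSpace ℝ E] [FiniteDimensional ℝ E]
  [MeasurableSpace E] [BorelSpace E]

/-- Translation is continuous in `L²`, tested against a fixed `L²` function. -/
theorem continuous_integral_mul_translate_of_memLp_two {f h : E → ℝ}
    (hf : MemLp f 2 volume) (hh : MemLp h 2 volume) :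
    Continuous fun t : E => ∫ x, f x * h (x - t) := by
  have key : ∀ t : E, ∫ x, f x * h (x - t)
      = inner ℝ (hf.toLp f) ((DomAddAct.mk (-t)) +ᵥ (hh.toLp h)) := by
    intro t
    rw [DomAddAct.mk_vadd_toLp, L2.inner_def]
    refine integral_congr_ae ?_
    filter_upwards [hf.coeFn_toLp,
      (hh.comp_measurePreserving (measurePreserving_vadd (-t) volume)).coeFn_toLp] with x h1 h2
    refine Eq.trans ?_ (congrArg₂ (fun a b : ℝ => inner ℝ a b) h1 h2).symm
    simp [mul_comm, sub_eq_neg_add]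
  simp_rw [key]
  have : Fact ((2 : ENNReal) ≠ ⊤) := ⟨by simp⟩
  have : Continuous fun t : E => (DomAddAct.mk (-t)) +ᵥ (hh.toLp h) := by
    have h1 : Continuous fun t : E => DomAddAct.mk (-t) :=
      DomAddAct.continuous_mk.comp continuous_neg
    exact h1.vadd continuous_const
  fun_prop

theorem continuous_integral_mul_translate_of_integrable {f h : E → ℝ}
    (hf : Integrable f) (hh : Continuous h) (hc : HasCompactSupport h) :
    Continuous fun t : E => ∫ x, f x * h (x - t) := by
  obtain ⟨C, hC⟩ := hc.exists_bound_of_continuous hh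
  refine continuous_of_dominated (bound := fun x => ‖f x‖ * C) ?_ ?_ ?_ ?_
  · intro t
    exact hf.aestronglyMeasurable.mul (by fun_prop)
  · intro t
    filter_upwards with x
    rw [norm_mul]
    gcongr
    exact hC _
  · exact hf.norm.mul_const _
  · filter_upwards with x
    fun_prop

theorem tendsto_integral_mul_normed_convolution {f h : E → ℝ}
    (hcont : Continuous fun t : E => ∫ x, f x * h (x - t))
    (hint : ∀ ρ : E → ℝ, Continuous ρ → HasCompactSupport ρ →
      Integrable (fun p : E × E => f p.1 * (ρ p.2 * h (p.1 - p.2))) (volume.prod volume))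
    {φ : ℕ → ContDiffBump (0 : E)} (hφ : Tendsto (fun i => (φ i).rOut) atTop (𝓝 0)) :
    Tendsto (fun i => ∫ x, f x * (((φ i).normed volume) ⋆[ContinuousLinearMap.lsmul ℝ ℝ] h) x)
      atTop (𝓝 (∫ x, f x * h x)) := by
  have h1 := ContDiffBump.convolution_tendsto_right_of_continuous (μ := volume) hφ
    (hcont.comp continuous_neg) (0 : E)
  simp only [Function.comp_def, neg_zero, sub_zero] at h1
  refine h1.congr fun i => ?_
  rw [convolution_def]
  simp only [convolution_def, zero_sub, neg_neg, ContinuousLinearMap.lsmul_apply, smul_eq_mul]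
  simp_rw [← integral_const_mul]
  rw [integral_integral_swap]
  · refine integral_congr_ae (Eventually.of_forall fun t => ?_)
    refine integral_congr_ae (Eventually.of_forall fun x => ?_)
    simp only
    ring
  · have := (hint _ ((φ i).continuous_normed (μ := volume))
      ((φ i).hasCompactSupport_normed (μ := volume))).swap
    refine this.congr (Eventually.of_forall fun p => ?_)
    simp [Function.uncurry]
    ring

theorem integrable_prod_mul_translate_of_memLp_two {f h ρ : E → ℝ}
    (hf : MemLp f 2 volume) (hh : MemLp h 2 volume) (hρ : Continuous ρ)
    (hρc : HasCompactSupport ρ) :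
    Integrable (fun p : E × E => f p.1 * (ρ p.2 * h (p.1 - p.2))) (volume.prod volume) := by
  have hρi : Integrable ρ := hρ.integrable_of_hasCompactSupport hρc
  have h1 : Integrable (fun p : E × E => (f p.1) ^ 2 * |ρ p.2|) (volume.prod volume) :=
    hf.integrable_sq.mul_prod hρi.abs
  have h2 : Integrable (fun p : E × E => |ρ p.2| * (h (p.1 - p.2)) ^ 2) (volume.prod volume) :=
    Integrable.convolution_integrand (ContinuousLinearMap.mul ℝ ℝ) hρi.abs hh.integrable_sq
  refine (h1.add h2).mono' ?_ (Eventually.of_forall fun p => ?_)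
  · refine hf.1.comp_fst.mul ?_
    exact AEStronglyMeasurable.convolution_integrand (ContinuousLinearMap.mul ℝ ℝ)
      hρi.aestronglyMeasurable hh.1
  · simp only [Pi.add_apply, norm_mul, Real.norm_eq_abs]
    rw [← sq_abs (f p.1), ← sq_abs (h _)]
    nlinarith [mul_nonneg (abs_nonneg (ρ p.2)) (sq_nonneg (|f p.1| - |h (p.1 - p.2)|)),
      mul_nonneg (abs_nonneg (ρ p.2)) (sq_nonneg (|f p.1| + |h (p.1 - p.2)|))]

theorem integrable_prod_mul_translate_of_integrable {f h ρ : E → ℝ}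
    (hf : Integrable f) (hh : Continuous h) (hc : HasCompactSupport h) (hρ : Continuous ρ)
    (hρc : HasCompactSupport ρ) :
    Integrable (fun p : E × E => f p.1 * (ρ p.2 * h (p.1 - p.2))) (volume.prod volume) := by
  obtain ⟨C, hC⟩ := hc.exists_bound_of_continuous hh
  have hρi : Integrable ρ := hρ.integrable_of_hasCompactSupport hρc
  have h1 := (hf.mul_prod hρi).mul_bdd (c := C)
    (g := fun p : E × E => h (p.1 - p.2)) (by fun_prop) (Eventually.of_forall fun p => hC _)
  simpa only [mul_assoc] using h1

theorem fderiv_convolution_apply_of_differentiable {h : E → ℝ} (hd : Differentiable ℝ h)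
    (v : E) (hi : LocallyIntegrable fun x => fderiv ℝ h x v)
    {ρ : E → ℝ} (hρ : ContDiff ℝ 1 ρ) (hρc : HasCompactSupport ρ) (x : E) :
    fderiv ℝ (ρ ⋆[ContinuousLinearMap.lsmul ℝ ℝ] h) x v
      = (ρ ⋆[ContinuousLinearMap.lsmul ℝ ℝ] fun y => fderiv ℝ h y v) x := by
  rw [(hρc.hasFDerivAt_convolution_left (ContinuousLinearMap.lsmul ℝ ℝ) hρ
    hd.continuous.locallyIntegrable x).fderiv]
  have hdρ : Continuous (fderiv ℝ ρ) := hρ.continuous_fderiv one_ne_zero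
  have he1 := ((hρc.fderiv ℝ).convolutionExists_left (μ := volume)
    ((ContinuousLinearMap.lsmul ℝ ℝ).precompL E) hdρ hd.continuous.locallyIntegrable x).integrable
  have hpt : ∀ t, ((ContinuousLinearMap.lsmul ℝ ℝ).precompL E
      (fderiv ℝ ρ t)) (h (x - t)) v
        = fderiv ℝ ρ t v * h (x - t) := fun t => by
    simp [ContinuousLinearMap.precompL_apply]
  have he2 : Integrable fun t => ρ t * fderiv ℝ h (x - t) v :=
    hρc.convolutionExists_left (ContinuousLinearMap.lsmul ℝ ℝ) hρ.continuous hi x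
  have hdg : ∀ t, HasFDerivAt (fun t => h (x - t)) (-(fderiv ℝ h (x - t))) t := by
    intro t
    have h1 : HasFDerivAt (fun t : E => x - t) (-(ContinuousLinearMap.id ℝ E)) t :=
      (hasFDerivAt_id t).const_sub x
    have h2 := (hd (x - t)).hasFDerivAt.comp t h1
    simpa [Function.comp_def] using h2
  have ibp := integral_mul_fderiv_eq_neg_fderiv_mul_of_integrable (μ := volume)
    (f := ρ) (g := fun t => h (x - t)) (v := v) ?_ ?_ ?_ ?_ ?_
  · rw [convolution_def, ContinuousLinearMap.integral_apply he1, convolution_def]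
    simp only [(hdg _).fderiv] at ibp
    simp only [ContinuousLinearMap.lsmul_apply, smul_eq_mul]
    simp only [_root_.neg_apply, mul_neg, integral_neg, neg_inj] at ibp
    rw [ibp]
    exact integral_congr_ae (Eventually.of_forall hpt)
  · have he := he1.apply_continuousLinearMap v
    exact he.congr (Eventually.of_forall hpt)
  · simp only [(hdg _).fderiv, _root_.neg_apply, mul_neg]
    exact he2.neg
  · exact hρc.convolutionExists_left (ContinuousLinearMap.lsmul ℝ ℝ) hρ.continuous
      hd.continuous.locallyIntegrable x
  · exact fun t _ => (hρ.differentiable one_ne_zero) t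
  · exact fun t _ => (hdg t).differentiableAt

theorem contDiff_normed_convolution {h : E → ℝ} (hh : Continuous h) (φ : ContDiffBump (0 : E)) :
    ContDiff ℝ (⊤ : ℕ∞) (φ.normed volume ⋆[ContinuousLinearMap.lsmul ℝ ℝ] h) :=
  (φ.hasCompactSupport_normed (μ := volume)).contDiff_convolution_left _ φ.contDiff_normed
    hh.locallyIntegrable

theorem tsupport_normed_convolution_subset {h : E → ℝ} (φ : ContDiffBump (0 : E)) {δ : ℝ}
    (hφ : φ.rOut ≤ δ) :
    tsupport (φ.normed volume ⋆[ContinuousLinearMap.lsmul ℝ ℝ] h)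
      ⊆ Metric.cthickening δ (tsupport h) := by
  refine closure_minimal ?_ Metric.isClosed_cthickening
  refine (support_convolution_subset _).trans ?_
  rintro _ ⟨a, ha, b, hb, rfl⟩
  rw [φ.support_normed_eq, mem_ball_zero_iff] at ha
  refine Metric.mem_cthickening_of_dist_le _ b _ _ (subset_tsupport _ hb) ?_
  simpa using ha.le.trans hφ

/-- A first-order linear equation in weak form with coefficients `f i ∈ L²_loc(Ω)` and
`q ∈ L¹_loc(Ω)`, valid against smooth test functions, is also valid against differentiable
compactly supported test functions with square integrable derivatives. -/
theorem integral_eq_zero_of_differentiable_of_forall_contDiff {ι : Type*} [Fintype ι] {Ω : Set E}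
    (hΩ : IsOpen Ω) (e : ι → E) {f : ι → E → ℝ} {q : E → ℝ}
    (hf : ∀ K, IsCompact K → K ⊆ Ω → ∀ i, MemLp (f i) 2 (volume.restrict K))
    (hq : ∀ K, IsCompact K → K ⊆ Ω → IntegrableOn q K)
    (hw : ∀ η : E → ℝ, ContDiff ℝ (⊤ : ℕ∞) η → HasCompactSupport η → tsupport η ⊆ Ω →
      ∫ x, (∑ i, f i x * fderiv ℝ η x (e i) + q x * η x) = 0)
    {η : E → ℝ} (hd : Differentiable ℝ η) (hc : HasCompactSupport η) (hs : tsupport η ⊆ Ω)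
    (hη : ∀ i, MemLp (fun x => fderiv ℝ η x (e i)) 2 volume) :
    Integrable (fun x => ∑ i, f i x * fderiv ℝ η x (e i) + q x * η x) ∧
      ∫ x, (∑ i, f i x * fderiv ℝ η x (e i) + q x * η x) = 0 := by
  obtain ⟨δ, hδ, hδs⟩ := hc.isCompact.exists_cthickening_subset_open hΩ hs
  set K := Metric.cthickening δ (tsupport η) with hK
  have hKc : IsCompact K := hc.isCompact.cthickening
  have hKm : MeasurableSet K := hKc.measurableSet
  let F : ι → E → ℝ := fun i => K.indicator (f i)
  let Q : E → ℝ := K.indicator q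
  have hF : ∀ i, MemLp (F i) 2 volume := fun i =>
    (memLp_indicator_iff_restrict hKm).2 (hf K hKc hδs i)
  have hQ : Integrable Q := (integrable_indicator_iff hKm).2 (hq K hKc hδs)
  have hrepl : ∀ ζ : E → ℝ, tsupport ζ ⊆ K → ∀ x,
      ∑ i, f i x * fderiv ℝ ζ x (e i) + q x * ζ x
        = ∑ i, F i x * fderiv ℝ ζ x (e i) + Q x * ζ x := by
    intro ζ hζ x
    by_cases hx : x ∈ K
    · simp [F, Q, hx]
    · have hx' : x ∉ tsupport ζ := fun h => hx (hζ h)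
      have h1 : fderiv ℝ ζ x = 0 := by
        by_contra h
        exact hx' (support_fderiv_subset ℝ h)
      simp [h1, image_eq_zero_of_notMem_tsupport hx']
  have hηK : tsupport η ⊆ K := Metric.self_subset_cthickening _
  obtain ⟨φ, hφ⟩ : ∃ φ : ℕ → ContDiffBump (0 : E), ∀ n, (φ n).rOut = δ / (n + 1) :=
    ⟨fun n => ⟨δ / (n + 1) / 2, δ / (n + 1), by positivity, half_lt_self (by positivity)⟩,
      fun n => rfl⟩
  have hφ0 : Tendsto (fun n => (φ n).rOut) atTop (𝓝 0) := by
    simp only [hφ]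
    exact tendsto_const_div_atTop_nhds_zero_nat δ |>.comp (tendsto_add_atTop_nat 1) |>.congr
      fun n => by simp
  have hφδ : ∀ n, (φ n).rOut ≤ δ := fun n => by
    rw [hφ]
    exact div_le_self hδ.le (by linarith [n.cast_nonneg (α := ℝ)])
  let ζ : ℕ → E → ℝ := fun n => (φ n).normed volume ⋆[ContinuousLinearMap.lsmul ℝ ℝ] η
  have hζc : ∀ n, ContDiff ℝ (⊤ : ℕ∞) (ζ n) := fun n =>
    contDiff_normed_convolution hd.continuous (φ n)
  have hζs : ∀ n, tsupport (ζ n) ⊆ K := fun n => tsupport_normed_convolution_subset _ (hφδ n)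
  have hζcs : ∀ n, HasCompactSupport (ζ n) := fun n =>
    hKc.of_isClosed_subset (isClosed_tsupport _) (hζs n)
  have hζd : ∀ n i x, fderiv ℝ (ζ n) x (e i)
      = ((φ n).normed volume ⋆[ContinuousLinearMap.lsmul ℝ ℝ] fun y => fderiv ℝ η y (e i)) x :=
    fun n i x => fderiv_convolution_apply_of_differentiable hd (e i)
      ((hη i).locallyIntegrable (by norm_num)) (φ n).contDiff_normed
      ((φ n).hasCompactSupport_normed) x
  have hsplit : ∀ ξ : E → ℝ, Continuous ξ → HasCompactSupport ξ →
      (∀ i, MemLp (fun x => fderiv ℝ ξ x (e i)) 2 volume) → tsupport ξ ⊆ K →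
      Integrable (fun x => ∑ i, f i x * fderiv ℝ ξ x (e i) + q x * ξ x) ∧
        ∫ x, (∑ i, f i x * fderiv ℝ ξ x (e i) + q x * ξ x)
          = (∑ i, ∫ x, F i x * fderiv ℝ ξ x (e i)) + ∫ x, Q x * ξ x := by
    intro ξ hξ hξc hξd hξK
    obtain ⟨C, hC⟩ := hξc.exists_bound_of_continuous hξ
    have h1 : ∀ i, Integrable fun x => F i x * fderiv ℝ ξ x (e i) := fun i =>
      (hF i).integrable_mul (hξd i)
    have h2 : Integrable fun x => Q x * ξ x :=
      hQ.mul_bdd (c := C) hξ.aestronglyMeasurable (Eventually.of_forall hC)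
    have h3 := integrable_finsetSum Finset.univ fun i _ => h1 i
    refine ⟨(h3.add h2).congr (Eventually.of_forall fun x => (hrepl ξ hξK x).symm), ?_⟩
    rw [integral_congr_ae (Eventually.of_forall (hrepl ξ hξK)), integral_add h3 h2,
      integral_finsetSum _ fun i _ => h1 i]
  have hlim : Tendsto (fun n => (∑ i, ∫ x, F i x * fderiv ℝ (ζ n) x (e i)) + ∫ x, Q x * ζ n x) atTop
      (𝓝 ((∑ i, ∫ x, F i x * fderiv ℝ η x (e i)) + ∫ x, Q x * η x)) := by
    simp only [hζd]
    refine Tendsto.add (tendsto_finsetSum _ fun i _ => ?_) ?_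
    · exact tendsto_integral_mul_normed_convolution
        (continuous_integral_mul_translate_of_memLp_two (hF i) (hη i))
        (fun ρ hρ hρc => integrable_prod_mul_translate_of_memLp_two (hF i) (hη i) hρ hρc) hφ0
    · exact tendsto_integral_mul_normed_convolution
        (continuous_integral_mul_translate_of_integrable hQ hd.continuous hc)
        (fun ρ hρ hρc => integrable_prod_mul_translate_of_integrable hQ hd.continuous hc hρ hρc) hφ0
  refine ⟨(hsplit η hd.continuous hc hη hηK).1, ?_⟩
  rw [(hsplit η hd.continuous hc hη hηK).2]
  refine tendsto_nhds_unique hlim (tendsto_const_nhds.congr fun n => ?_)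
  rw [← (hsplit (ζ n) (hζc n).continuous (hζcs n) (fun i => ?_) (hζs n)).2,
    hw (ζ n) (hζc n) (hζcs n) ((hζs n).trans hδs)]
  have h1 : Continuous fun x => fderiv ℝ (ζ n) x (e i) :=
    ((hζc n).continuous_fderiv (by simp)).clm_apply continuous_const
  exact h1.memLp_of_hasCompactSupport ((hζcs n).fderiv_apply ℝ (e i))

/-- A continuous function on a connected open set, differentiable there with almost everywhere
vanishing gradient, is constant. -/
theorem eq_of_ae_fderiv_eq_zero {Ω : Set E} (hΩ : IsOpen Ω) (hΩc : IsPreconnected Ω) {g : E → ℝ}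
    (hg : DifferentiableOn ℝ g Ω) (h0 : ∀ᵐ x, x ∈ Ω → fderiv ℝ g x = 0)
    {x y : E} (hx : x ∈ Ω) (hy : y ∈ Ω) : g x = g y := by
  have hgd : ∀ z ∈ Ω, DifferentiableAt ℝ g z := fun z hz => hg.differentiableAt (hΩ.mem_nhds hz)
  have key : ∀ v : E, ∀ᵐ z, (∀ t ∈ Set.Icc (0 : ℝ) 1, z + t • v ∈ Ω) → g (z + v) = g z := by
    intro v
    have h1 : ∀ᵐ z : E, ∀ᵐ t : ℝ, z + t • v ∈ Ω → fderiv ℝ g (z + t • v) = 0 := by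
      have hm : MeasurableSet {w : E | w ∈ Ω → fderiv ℝ g w = 0} := by
        have h2 : MeasurableSet (Ωᶜ ∪ {w : E | fderiv ℝ g w = 0}) :=
          hΩ.measurableSet.compl.union (measurable_fderiv ℝ g (measurableSet_singleton 0))
        convert h2 using 1
        ext w
        simp [imp_iff_not_or]
      have hm' : MeasurableSet {p : E × ℝ |
          p.1 + p.2 • v ∈ Ω → fderiv ℝ g (p.1 + p.2 • v) = 0} :=
        (show Measurable fun p : E × ℝ => p.1 + p.2 • v by fun_prop) hm
      refine (Measure.ae_ae_comm hm').2 (Eventually.of_forall fun t => ?_)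
      exact (measurePreserving_add_right volume (t • v)).quasiMeasurePreserving.ae h0
    filter_upwards [h1] with z hz hseg
    have hder : ∀ t ∈ Set.uIcc (0 : ℝ) 1,
        HasDerivAt (fun t : ℝ => g (z + t • v)) (fderiv ℝ g (z + t • v) v) t := by
      intro t ht
      rw [Set.uIcc_of_le zero_le_one] at ht
      have h2 : HasDerivAt (fun t : ℝ => z + t • v) v t := by
        simpa using ((hasDerivAt_id t).smul_const v).const_add z
      exact (hgd _ (hseg t ht)).hasFDerivAt.comp_hasDerivAt t h2
    have hz0 : (fun t : ℝ => fderiv ℝ g (z + t • v) v)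
        =ᵐ[volume.restrict (Set.uIoc (0 : ℝ) 1)] fun _ => (0 : ℝ) := by
      refine (ae_restrict_iff' measurableSet_uIoc).2 ?_
      filter_upwards [hz] with t ht htm
      rw [Set.uIoc_of_le zero_le_one] at htm
      simp [ht (hseg t ⟨htm.1.le, htm.2⟩)]
    have hint : IntervalIntegrable (fun t : ℝ => fderiv ℝ g (z + t • v) v) volume 0 1 :=
      (intervalIntegrable_iff.2 ((integrable_congr hz0).2 (integrable_zero _ _ _)))
    have := intervalIntegral.integral_eq_sub_of_hasDerivAt hder hint
    rw [intervalIntegral.integral_congr_ae_restrict hz0] at this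
    simp at this
    linarith
  have hloc : ∀ z ∈ Ω, ∀ᶠ w in 𝓝 z, g w = g z := by
    intro z hz
    obtain ⟨r, hr, hrs⟩ := Metric.isOpen_iff.1 hΩ z hz
    filter_upwards [Metric.ball_mem_nhds z hr] with w hw
    have hzw : ∀ t ∈ Set.Icc (0 : ℝ) 1, z + t • (w - z) ∈ Ω := fun t ht => hrs <|
      (convex_ball z r).add_smul_sub_mem (Metric.mem_ball_self hr) hw ht
    have hev : ∀ᶠ u in 𝓝 z, ∀ t ∈ Set.Icc (0 : ℝ) 1, u + t • (w - z) ∈ Ω := by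
      refine isCompact_Icc.eventually_forall_of_forall_eventually fun t ht => ?_
      have hcont : Continuous fun p : E × ℝ => p.1 + p.2 • (w - z) := by fun_prop
      exact hcont.continuousAt.eventually (hΩ.mem_nhds (hzw t ht))
    have hfreq : ∃ᶠ u in 𝓝 z, g (u + (w - z)) - g u = 0 := by
      refine ((mem_closure_iff_frequently.1
        (Measure.dense_of_ae (key (w - z)) z)).and_eventually hev).mono fun u hu => ?_
      rw [hu.1 hu.2, sub_self]
    have hcont : ContinuousAt (fun u => g (u + (w - z)) - g u) z := by
      refine ContinuousAt.sub ?_ (hgd z hz).continuousAt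
      have hw' : DifferentiableAt ℝ g (z + (w - z)) := hgd _ (by simpa using hrs hw)
      exact ContinuousAt.comp (f := fun u => u + (w - z)) hw'.continuousAt (by fun_prop)
    have hlim : g (z + (w - z)) - g z = 0 := by
      by_contra hne
      exact hfreq (hcont.eventually_ne hne)
    rw [add_sub_cancel] at hlim
    linarith
  refine hΩ.is_const_of_fderiv_eq_zero hΩc hg (fun z hz => ?_) hx hy
  have hz' : g =ᶠ[𝓝 z] fun _ => g z := hloc z hz
  simp [hz'.fderiv_eq]

end Mollification

section Lifting

variable {E : Type*} [NormedAddCommGroup E] [NormedSpace ℝ E]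

theorem isSimplyConnected_compl_ray {w : E} (hw : w ≠ 0) :
    IsSimplyConnected ((fun s : ℝ => s • w) '' Set.Ici 0)ᶜ := by
  have hw' : -w ∈ ((fun s : ℝ => s • w) '' Set.Ici 0)ᶜ := by
    rintro ⟨s, hs, h⟩
    have h1 : (s + 1) • w = 0 := by
      rw [add_smul, one_smul]
      exact add_eq_zero_iff_eq_neg.2 h
    rcases smul_eq_zero.1 h1 with h2 | h2
    · have : (0 : ℝ) ≤ s := hs
      linarith
    · exact hw h2
  have hstar : StarConvex ℝ (-w) ((fun s : ℝ => s • w) '' Set.Ici 0)ᶜ := by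
    rintro y hy a b ha hb hab ⟨s, hs, h⟩
    have hs' : (0 : ℝ) ≤ s := hs
    rcases hb.eq_or_lt with rfl | hb
    · refine hw' ⟨s, hs, ?_⟩
      have : a = 1 := by linarith
      simpa [this] using h
    · refine hy ⟨(s + a) / b, div_nonneg (add_nonneg hs' ha) hb.le, ?_⟩
      have h2 : b • y = (s + a) • w := by
        simp only [smul_neg] at h
        rw [add_smul, h]
        abel
      simp only
      rw [div_eq_inv_mul, mul_smul, ← h2, smul_smul, inv_mul_cancel₀ hb.ne', one_smul]
  have := hstar.contractibleSpace ⟨_, hw'⟩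
  exact SimplyConnectedSpace.ofContractible _

theorem isOpen_compl_ray {w : E} (hw : w ≠ 0) :
    IsOpen ((fun s : ℝ => s • w) '' Set.Ici 0)ᶜ :=
  ((isClosedEmbedding_smul_left hw).isClosedMap _ isClosed_Ici).isOpen_compl

theorem exists_real_lift_of_isSimplyConnected {D : Set E} (hD : IsOpen D)
    (hDc : IsSimplyConnected D) {d : E → ℂ} (hd : ContinuousOn d D) (h1 : ∀ x ∈ D, ‖d x‖ = 1) :
    ∃ g : E → ℝ, ContinuousOn g D ∧ ∀ x ∈ D, Complex.exp (g x * Complex.I) = d x := by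
  obtain ⟨L, hL, hLd⟩ := Complex.exists_continuousOn_eqOn_exp_comp hDc hD hd (by
    rintro ⟨x, hx, h0⟩
    simpa [h0] using h1 x hx)
  refine ⟨fun x => (L x).im, Complex.continuous_im.comp_continuousOn hL, fun x hx => ?_⟩
  have h2 : Complex.exp (L x) = d x := hLd hx
  have h3 : (L x).re = 0 := by
    have := h1 x hx
    rwa [← h2, Complex.norm_exp, Real.exp_eq_one_iff] at this
  rw [← h2]
  congr 1
  apply Complex.ext <;> simp [h3]

/-- In dimension at least three, a continuous circle-valued function on the complement of the
origin has a continuous real phase. -/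
theorem exists_real_lift_compl_zero (hE : 2 < Module.rank ℝ E) {d : E → ℂ}
    (hd : ContinuousOn d {x | x ≠ 0}) (h1 : ∀ x, x ≠ 0 → ‖d x‖ = 1) :
    ∃ g : E → ℝ, ContinuousOn g {x | x ≠ 0} ∧
      ∀ x, x ≠ 0 → Complex.exp (g x * Complex.I) = d x := by
  obtain ⟨w, hw⟩ : ∃ w : E, w ≠ 0 := by
    have : Nontrivial E := rank_pos_iff_nontrivial.1 ((by norm_num : (0 : Cardinal) < 2).trans hE)
    exact exists_ne 0
  set A : Set E := ((fun s : ℝ => s • w) '' Set.Ici 0)ᶜ with hA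
  set B : Set E := ((fun s : ℝ => s • (-w)) '' Set.Ici 0)ᶜ with hB
  have hw' : -w ≠ 0 := neg_ne_zero.2 hw
  have hAo : IsOpen A := isOpen_compl_ray hw
  have hBo : IsOpen B := isOpen_compl_ray hw'
  have hA0 : ∀ x ∈ A, x ≠ 0 := by
    rintro x hx rfl
    exact hx ⟨0, Set.self_mem_Ici, by simp⟩
  have hB0 : ∀ x ∈ B, x ≠ 0 := by
    rintro x hx rfl
    exact hx ⟨0, Set.self_mem_Ici, by simp⟩
  have hAB : ∀ x : E, x ≠ 0 → x ∉ A → x ∈ B := by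
    rintro x hx hxA ⟨t, ht, h⟩
    obtain ⟨s, hs, h'⟩ := Set.notMem_compl_iff.1 hxA
    simp only at h h'
    have hs' : (0 : ℝ) ≤ s := hs
    have ht' : (0 : ℝ) ≤ t := ht
    have h2 : (s + t) • w = 0 := by
      rw [add_smul, h', ← h, smul_neg, neg_add_cancel]
    rcases smul_eq_zero.1 h2 with h3 | h3
    · have : s = 0 := by linarith
      exact hx (by rw [← h', this, zero_smul])
    · exact hw h3
  have hinter : A ∩ B = ((ℝ ∙ w : Submodule ℝ E) : Set E)ᶜ := by
    ext x
    simp only [hA, hB, Set.mem_inter_iff, Set.mem_compl_iff, SetLike.mem_coe,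
      Submodule.mem_span_singleton, ← not_or, not_iff_not]
    constructor
    · rintro (⟨s, -, h⟩ | ⟨s, -, h⟩)
      · exact ⟨s, h⟩
      · exact ⟨-s, by simpa using h⟩
    · rintro ⟨s, h⟩
      rcases le_total 0 s with hs | hs
      · exact Or.inl ⟨s, hs, h⟩
      · exact Or.inr ⟨-s, by simpa using hs, by simpa using h⟩
  have hconn : IsConnected (A ∩ B) := by
    rw [hinter]
    refine isConnected_compl_of_one_lt_codim ?_
    by_contra! hle
    have h2 := Submodule.rank_quotient_add_rank (ℝ ∙ w : Submodule ℝ E)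
    have h3 : Module.rank ℝ (ℝ ∙ w : Submodule ℝ E) ≤ 1 :=
      (rank_span_le _).trans (by simp)
    have h4 : Module.rank ℝ E ≤ 1 + 1 := h2 ▸ add_le_add hle h3
    rw [one_add_one_eq_two] at h4
    exact absurd hE h4.not_gt
  obtain ⟨g₁, hg₁, hg₁d⟩ := exists_real_lift_of_isSimplyConnected hAo
    (isSimplyConnected_compl_ray hw) (hd.mono hA0) fun x hx => h1 x (hA0 x hx)
  obtain ⟨g₂, hg₂, hg₂d⟩ := exists_real_lift_of_isSimplyConnected hBo
    (isSimplyConnected_compl_ray hw') (hd.mono hB0) fun x hx => h1 x (hB0 x hx)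
  obtain ⟨z, hz⟩ := hconn.nonempty
  have hexpc : Complex.exp ((g₁ z - g₂ z : ℝ) * Complex.I) = 1 := by
    push_cast
    rw [sub_mul, Complex.exp_sub, hg₁d z hz.1, hg₂d z hz.2, div_self]
    exact norm_ne_zero_iff.1 (by rw [h1 z (hA0 z hz.1)]; exact one_ne_zero)
  have hg₂d' : ∀ x ∈ B, Complex.exp ((g₂ x + (g₁ z - g₂ z) : ℝ) * Complex.I) = d x := by
    intro x hx
    rw [Complex.ofReal_add, add_mul, Complex.exp_add, hexpc, mul_one, hg₂d x hx]
  have heq : Set.EqOn g₁ (fun x => g₂ x + (g₁ z - g₂ z)) (A ∩ B) := by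
    refine Circle.isCoveringMap_exp.eqOn_of_comp_eqOn hconn.isPreconnected
      (hg₁.mono Set.inter_subset_left)
      ((hg₂.mono Set.inter_subset_right).add continuousOn_const) ?_ hz (by ring)
    intro x hx
    ext
    simp only [Function.comp_apply, Circle.coe_exp]
    rw [hg₁d x hx.1, hg₂d' x hx.2]
  classical
  refine ⟨fun x => if x ∈ A then g₁ x else g₂ x + (g₁ z - g₂ z), ?_, ?_⟩
  · intro x hx
    refine ContinuousAt.continuousWithinAt ?_
    by_cases hxA : x ∈ A
    · refine (hg₁.continuousAt (hAo.mem_nhds hxA)).congr ?_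
      filter_upwards [hAo.mem_nhds hxA] with y hy
      simp [hy]
    · have hxB := hAB x hx hxA
      refine ((hg₂.continuousAt (hBo.mem_nhds hxB)).add_const (g₁ z - g₂ z)).congr ?_
      filter_upwards [hBo.mem_nhds hxB] with y hy
      split_ifs with hyA
      · exact (heq ⟨hyA, hy⟩).symm
      · rfl
  · intro x hx
    by_cases hxA : x ∈ A
    · simp only [if_pos hxA]
      exact hg₁d x hxA
    · simp only [if_neg hxA]
      exact hg₂d' x (hAB x hx hxA)

/-- A continuous phase of a differentiable circle-valued function is differentiable. -/
theorem hasFDerivAt_of_exp_mul_I_eq {d : E → ℂ} {g : E → ℝ} {x : E} {d' : E →L[ℝ] ℂ}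
    (hg : ContinuousAt g x) (hgd : ∀ᶠ y in 𝓝 x, Complex.exp (g y * Complex.I) = d y)
    (hd : HasFDerivAt d d' x) :
    HasFDerivAt g (Complex.imCLM ∘L ((d x)⁻¹ • d')) x := by
  have hdx : Complex.exp (g x * Complex.I) = d x := hgd.self_of_nhds
  have hdx0 : d x ≠ 0 := hdx ▸ Complex.exp_ne_zero _
  have h1 : HasFDerivAt (fun y => (d x)⁻¹ * d y) ((d x)⁻¹ • d') x := hd.const_mul _
  have h2 := (Complex.hasStrictFDerivAt_log_real (x := (d x)⁻¹ * d x)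
    (by simp [hdx0])).hasFDerivAt.comp x h1
  have h3 := (Complex.imCLM.hasFDerivAt.comp x h2).const_add (g x)
  have h4 : g =ᶠ[𝓝 x] fun y => g x + (Complex.log ((d x)⁻¹ * d y)).im := by
    have hnear : ∀ᶠ y in 𝓝 x, |g y - g x| < Real.pi := by
      have := (hg.sub_const (g x)).abs
      simp only [sub_self, abs_zero] at this
      exact this.eventually_lt_const Real.pi_pos
    filter_upwards [hgd, hnear] with y hy hy2
    rw [← hdx, ← hy, ← Complex.exp_neg, ← Complex.exp_add]
    rw [abs_lt] at hy2
    rw [Complex.log_exp]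
    · simp
    · simp; linarith
    · simp; linarith
  refine HasFDerivAt.congr_of_eventuallyEq ?_ h4
  simpa [hdx0, ContinuousLinearMap.one_def] using h3

end Lifting

section MatrixCalculus

variable {n : Type*} [Fintype n]
variable {V : Type*} [NormedAddCommGroup V] [NormedSpace ℝ V]

theorem trace_conjTranspose_mul_self_im (A : Matrix n n ℂ) : (Aᴴ * A).trace.im = 0 := by
  have h1 : star (Aᴴ * A).trace = (Aᴴ * A).trace := by
    rw [← Matrix.trace_conjTranspose]
    simp
  exact Complex.conj_eq_iff_im.1 h1

variable [DecidableEq n]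

theorem differentiable_matrix_det : Differentiable ℝ fun M : Matrix n n ℂ => M.det := by
  have hentry : ∀ i j, Differentiable ℝ fun M : Matrix n n ℂ => M i j := fun i j =>
    (LinearMap.toContinuousLinearMap
      (Matrix.entryLinearMap ℝ ℂ i j : Matrix n n ℂ →ₗ[ℝ] ℂ)).differentiable
  simp only [Matrix.det_apply]
  refine Differentiable.fun_sum fun σ _ => Differentiable.const_smul ?_ _
  have hprod := Finset.prod_induction (s := Finset.univ) (fun i (M : Matrix n n ℂ) => M (σ i) i)
    (Differentiable ℝ) (fun _ _ h₁ h₂ => h₁.mul h₂) (differentiable_const (1 : ℂ))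
    (fun i _ => hentry _ _)
  have heq : (∏ i, fun M : Matrix n n ℂ => M (σ i) i) = fun M => ∏ i, M (σ i) i := by
    ext M
    simp
  rwa [heq] at hprod

theorem fderiv_matrix_det_one (B : Matrix n n ℂ) :
    fderiv ℝ (fun M : Matrix n n ℂ => M.det) 1 B = B.trace := by
  have h1 : HasDerivAt (fun t : ℝ => (1 + t • B).det)
      (fderiv ℝ (fun M : Matrix n n ℂ => M.det) 1 B) 0 := by
    have h2 : HasDerivAt (fun t : ℝ => 1 + t • B) B 0 := by
      have := (hasDerivAt_id (0 : ℝ)).smul_const B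
      rw [one_smul] at this
      exact this.const_add 1
    have h3 := (differentiable_matrix_det (n := n) (1 + (0 : ℝ) • B)).hasFDerivAt.comp_hasDerivAt
      (0 : ℝ) h2
    have h4 : (1 : Matrix n n ℂ) + (0 : ℝ) • B = 1 := by simp
    rw [h4] at h3
    exact h3
  let P : Polynomial ℂ := (Matrix.det (1 + (Polynomial.X : Polynomial ℂ) • B.map Polynomial.C))
  have hP : ∀ t : ℝ, (1 + t • B).det = P.eval (t : ℂ) := by
    intro t
    have := Matrix.det_one_add_smul (t : ℂ) B
    have hP2 := congrArg (Polynomial.eval (t : ℂ)) (Matrix.det_one_add_X_smul B)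
    have h4 : t • B = (t : ℂ) • B := by ext; simp
    rw [h4, this]
    simpa [P] using hP2.symm
  have h5 : HasDerivAt (fun t : ℝ => P.eval (t : ℂ))
      ((Polynomial.derivative P).eval ((0 : ℝ) : ℂ)) 0 :=
    (P.hasDerivAt ((0 : ℝ) : ℂ)).comp_ofReal
  simp only [hP] at h1
  rw [h1.unique h5]
  simpa [P] using Matrix.derivative_det_one_add_X_smul B

theorem HasFDerivAt.matrix_const_mul {F : V → Matrix n n ℂ} {F' : V →L[ℝ] Matrix n n ℂ} {x : V}
    (hF : HasFDerivAt F F' x) (A : Matrix n n ℂ) :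
    HasFDerivAt (fun y => A * F y)
      ((LinearMap.toContinuousLinearMap (LinearMap.mulLeft ℝ A)) ∘L F') x :=
  (LinearMap.toContinuousLinearMap (LinearMap.mulLeft ℝ A)).hasFDerivAt.comp x hF

/-- Jacobi's formula along a map which is unitary at the base point. -/
theorem hasFDerivAt_det_of_mem_unitaryGroup {F : V → Matrix n n ℂ} {x : V}
    (hF : DifferentiableAt ℝ F x) (hx : F x ∈ Matrix.unitaryGroup n ℂ) :
    ∃ D : V →L[ℝ] ℂ, HasFDerivAt (fun y => (F y).det) D x ∧
      ∀ v, D v = (F x).det * ((F x)ᴴ * fderiv ℝ F x v).trace := by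
  have hu : (F x)ᴴ * F x = 1 := Matrix.mem_unitaryGroup_iff'.1 hx
  have hu' : F x * (F x)ᴴ = 1 := Matrix.mem_unitaryGroup_iff.1 hx
  have h1 := hF.hasFDerivAt.matrix_const_mul (F x)ᴴ
  have h2 := (differentiable_matrix_det (n := n) ((F x)ᴴ * F x)).hasFDerivAt.comp x h1
  have h3 := h2.const_mul (F x).det
  refine ⟨_, h3.congr_of_eventuallyEq (Eventually.of_forall fun y => ?_), fun v => ?_⟩
  · simp only [Function.comp_apply]
    rw [← Matrix.det_mul, ← mul_assoc, hu', one_mul]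
  · have h4 := fderiv_matrix_det_one ((F x)ᴴ * fderiv ℝ F x v)
    rw [← hu] at h4
    exact congrArg ((F x).det * ·) h4

theorem conjTranspose_mul_fderiv_add_eq_zero {F : V → Matrix n n ℂ} {x : V}
    (hF : DifferentiableAt ℝ F x) (hu : ∀ y, F y ∈ Matrix.unitaryGroup n ℂ) (v : V) :
    (fderiv ℝ F x v)ᴴ * F x + (F x)ᴴ * fderiv ℝ F x v = 0 := by
  let B : Matrix n n ℂ →L[ℝ] Matrix n n ℂ →L[ℝ] Matrix n n ℂ :=
    LinearMap.toContinuousLinearMap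
      ((LinearMap.toContinuousLinearMap : (Matrix n n ℂ →ₗ[ℝ] Matrix n n ℂ) ≃ₗ[ℝ] _).toLinearMap ∘ₗ
        LinearMap.mul ℝ (Matrix n n ℂ))
  let S : Matrix n n ℂ →L[ℝ] Matrix n n ℂ := LinearMap.toContinuousLinearMap
    (Matrix.conjTransposeLinearEquiv n n ℝ ℂ).toLinearMap
  have h1 := (S.hasFDerivAt.comp x hF.hasFDerivAt)
  have h2 := B.hasFDerivAt_of_bilinear h1 hF.hasFDerivAt
  have h3 : (fun y => B ((S ∘ F) y) (F y)) = fun _ => 1 := by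
    funext y
    exact Matrix.mem_unitaryGroup_iff'.1 (hu y)
  have h4 := congrArg (fun L : V →L[ℝ] Matrix n n ℂ => L v)
    (h2.unique ((hasFDerivAt_const 1 x).congr_of_eventuallyEq (Eventually.of_forall (congrFun h3))))
  rw [add_comm]
  exact h4

end MatrixCalculus

theorem aestronglyMeasurable_fderiv_apply {E F : Type*} [NormedAddCommGroup E] [NormedSpace ℝ E]
    [MeasurableSpace E] [OpensMeasurableSpace E] [NormedAddCommGroup F] [NormedSpace ℝ F]
    [FiniteDimensional ℝ F] (φ : E → F) (v : E) (μ : Measure E) :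
    AEStronglyMeasurable (fun x => fderiv ℝ φ x v) μ := by
  borelize F
  have : CompleteSpace F := FiniteDimensional.complete ℝ _
  have : ProperSpace F := FiniteDimensional.proper ℝ _
  exact (measurable_fderiv_apply_const ℝ φ v).aestronglyMeasurable

section WeakEquation

variable {E : Type*} [NormedAddCommGroup E] [InnerProductSpace ℝ E] [FiniteDimensional ℝ E]
  [MeasurableSpace E] [BorelSpace E]
variable {ι : Type*} [Fintype ι]

theorem memLp_fderiv_apply {F : Type*} [NormedAddCommGroup F] [NormedSpace ℝ F]
    [FiniteDimensional ℝ F] {U : E → F} {e : ι → E} {K : Set E}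
    (h : IntegrableOn (fun x => ∑ j, ‖fderiv ℝ U x (e j)‖ ^ 2) K volume) (j : ι) :
    MemLp (fun x => fderiv ℝ U x (e j)) 2 (volume.restrict K) := by
  have hm : AEStronglyMeasurable (fun x => fderiv ℝ U x (e j)) (volume.restrict K) :=
    aestronglyMeasurable_fderiv_apply _ _ _
  rw [memLp_two_iff_integrable_sq_norm hm]
  refine Integrable.mono' h (hm.norm.pow 2) (Eventually.of_forall fun x => ?_)
  rw [Real.norm_of_nonneg (by positivity)]
  exact Finset.single_le_sum (f := fun j => ‖fderiv ℝ U x (e j)‖ ^ 2) (fun i _ => by positivity)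
    (Finset.mem_univ j)

theorem integrableOn_sum_mul_mul {R : Type*} [NormedRing R] {A : ι → E → R} {V : E → R} {K : Set E}
    (hK : IsCompact K) (hV : ContinuousOn V K) (hA : ∀ j, MemLp (A j) 2 (volume.restrict K)) :
    IntegrableOn (fun x => ∑ j, A j x * V x * A j x) K volume := by
  obtain ⟨C, hC⟩ := hK.exists_bound_of_continuousOn hV
  have hVm : AEStronglyMeasurable V (volume.restrict K) :=
    hV.aestronglyMeasurable_of_isCompact hK hK.measurableSet
  refine integrable_finsetSum _ fun j _ => ?_
  refine Integrable.mono' ((hA j).integrable_norm_pow two_ne_zero |>.const_mul C)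
    (((hA j).1.mul hVm).mul (hA j).1) (ae_restrict_of_forall_mem hK.measurableSet fun x hx => ?_)
  have hCx := hC x hx
  calc ‖A j x * V x * A j x‖ ≤ ‖A j x‖ * ‖V x‖ * ‖A j x‖ :=
        (norm_mul_le _ _).trans (by gcongr; exact norm_mul_le _ _)
    _ = ‖V x‖ * ‖A j x‖ ^ 2 := by ring
    _ ≤ C * ‖A j x‖ ^ 2 := by gcongr

/-- Density of smooth test functions, for systems: a weak equation tested against smooth maps may
be tested against differentiable maps whose derivative is square integrable. -/
theorem integral_bilin_eq_zero_of_differentiable {F : Type*} [NormedAddCommGroup F]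
    [NormedSpace ℝ F] [FiniteDimensional ℝ F] (T : F →L[ℝ] F →L[ℝ] ℝ) {Ω : Set E}
    (hΩ : IsOpen Ω) (e : ι → E) {A : ι → E → F} {Q : E → F}
    (hA : ∀ K, IsCompact K → K ⊆ Ω → ∀ j, MemLp (A j) 2 (volume.restrict K))
    (hQ : ∀ K, IsCompact K → K ⊆ Ω → IntegrableOn Q K)
    (hw : ∀ φ : E → F, ContDiff ℝ (⊤ : ℕ∞) φ → HasCompactSupport φ → tsupport φ ⊆ Ω →
      ∫ x, ((∑ j, T (A j x) (fderiv ℝ φ x (e j))) + T (Q x) (φ x)) = 0)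
    {φ : E → F} (hφ : Differentiable ℝ φ) (hc : HasCompactSupport φ) (hs : tsupport φ ⊆ Ω)
    (hL2 : ∀ j, MemLp (fun x => fderiv ℝ φ x (e j)) 2 volume) :
    ∫ x, ((∑ j, T (A j x) (fderiv ℝ φ x (e j))) + T (Q x) (φ x)) = 0 := by
  let b := Module.finBasis ℝ F
  let c : Fin (Module.finrank ℝ F) → F →L[ℝ] ℝ := fun k =>
    LinearMap.toContinuousLinearMap (b.coord k)
  have hexp : ∀ f g : F, T f g = ∑ k, T f (b k) * c k g := by
    intro f g
    conv_lhs => rw [← b.sum_repr g]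
    simp only [map_sum, map_smul, smul_eq_mul]
    exact Finset.sum_congr rfl fun k _ => mul_comm _ _
  have hder : ∀ k x v, fderiv ℝ (fun y => c k (φ y)) x v = c k (fderiv ℝ φ x v) := by
    intro k x v
    have h : HasFDerivAt (fun y => c k (φ y)) ((c k) ∘L fderiv ℝ φ x) x :=
      (c k).hasFDerivAt.comp x (hφ x).hasFDerivAt
    rw [h.fderiv]
    rfl
  have key : ∀ k, Integrable (fun x => (∑ j, T (A j x) (b k) *
        fderiv ℝ (fun y => c k (φ y)) x (e j)) + T (Q x) (b k) * c k (φ x)) ∧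
      ∫ x, ((∑ j, T (A j x) (b k) *
        fderiv ℝ (fun y => c k (φ y)) x (e j)) + T (Q x) (b k) * c k (φ x)) = 0 := by
    intro k
    have hcz : (c k) 0 = 0 := map_zero _
    refine integral_eq_zero_of_differentiable_of_forall_contDiff hΩ e ?_ ?_ ?_ ?_ ?_ ?_ ?_
    · intro K hK hKs j
      exact (T.flip (b k)).comp_memLp' (hA K hK hKs j)
    · intro K hK hKs
      exact (T.flip (b k)).integrable_comp (hQ K hK hKs)
    · intro η hη hηc hηs
      have hsub : tsupport (fun x => η x • b k) ⊆ tsupport η :=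
        closure_mono fun x hx h => hx (by simp [h])
      have := hw (fun x => η x • b k) (hη.smul contDiff_const) hηc.smul_right (hsub.trans hηs)
      rw [← this]
      refine integral_congr_ae (Eventually.of_forall fun x => ?_)
      have hd := fderiv_smul_const (hη.differentiable (by simp) x) (b k)
      simp [hd, mul_comm]
    · exact (c k).differentiable.comp hφ
    · exact hc.comp_left hcz
    · exact (closure_mono (Function.support_comp_subset hcz φ)).trans hs
    · intro j
      simp only [hder]
      exact (c k).comp_memLp' (hL2 j)
  calc _ = ∫ x, ∑ k, ((∑ j, T (A j x) (b k) *
        fderiv ℝ (fun y => c k (φ y)) x (e j)) + T (Q x) (b k) * c k (φ x)) := by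
        refine integral_congr_ae (Eventually.of_forall fun x => ?_)
        simp only [hder, Finset.sum_add_distrib]
        rw [Finset.sum_comm]
        simp only [← hexp]
    _ = 0 := by
        rw [integral_finsetSum _ fun k _ => (key k).1]
        exact Finset.sum_eq_zero fun k _ => (key k).2

end WeakEquation

section ConservationLaw

variable {E : Type*} [NormedAddCommGroup E] [InnerProductSpace ℝ E] [FiniteDimensional ℝ E]
  [MeasurableSpace E] [BorelSpace E]
variable {F : Type*} [NormedAddCommGroup F] [NormedSpace ℝ F]

theorem MeasureTheory.MemLp.of_restrict_tsupport {φ : E → F} {v : E}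
    (h : MemLp (fun x => fderiv ℝ φ x v) 2 (volume.restrict (tsupport φ))) :
    MemLp (fun x => fderiv ℝ φ x v) 2 volume := by
  rw [← memLp_indicator_iff_restrict (isClosed_tsupport φ).measurableSet,
    Set.indicator_eq_self.2] at h
  · exact h
  · intro x hx
    by_contra hxs
    exact hx (by simp [fderiv_of_notMem_tsupport ℝ hxs])

variable [FiniteDimensional ℝ F]

theorem memLp_fderiv_smul {Ω K : Set E} (hΩ : IsOpen Ω) (hK : IsCompact K) (hKs : K ⊆ Ω)
    {f : E → ℝ} {W : E → F} (hf : DifferentiableOn ℝ f Ω) (hW : DifferentiableOn ℝ W Ω) {v : E}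
    (hf2 : MemLp (fun x => fderiv ℝ f x v) 2 (volume.restrict K))
    (hW2 : MemLp (fun x => fderiv ℝ W x v) 2 (volume.restrict K)) :
    MemLp (fun x => fderiv ℝ (fun y => f y • W y) x v) 2 (volume.restrict K) := by
  obtain ⟨C, hC⟩ := hK.exists_bound_of_continuousOn (hf.continuousOn.mono hKs)
  obtain ⟨D, hD⟩ := hK.exists_bound_of_continuousOn (hW.continuousOn.mono hKs)
  refine ((hW2.norm.const_mul C).add (hf2.norm.const_mul D)).mono'
    (aestronglyMeasurable_fderiv_apply _ _ _)
    (ae_restrict_of_forall_mem hK.measurableSet fun x hx => ?_)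
  have hx' := hΩ.mem_nhds (hKs hx)
  rw [fderiv_fun_smul (hf.differentiableAt hx') (hW.differentiableAt hx')]
  have h1 := hC x hx
  have h2 := hD x hx
  calc ‖f x • fderiv ℝ W x v + fderiv ℝ f x v • W x‖
      ≤ ‖f x‖ * ‖fderiv ℝ W x v‖ + ‖W x‖ * ‖fderiv ℝ f x v‖ := by
        refine (norm_add_le _ _).trans_eq ?_
        rw [norm_smul, norm_smul, mul_comm ‖W x‖]
    _ ≤ C * ‖fderiv ℝ W x v‖ + D * ‖fderiv ℝ f x v‖ := by gcongr

variable {ι : Type*} [Fintype ι]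

/-- Conservation law for a weak solution `U` of a system with an infinitesimal symmetry `L`, tested
against `χ` times the potential `g` of the conserved current. -/
theorem ae_mul_sum_sq_eq_zero_of_weak (T : F →L[ℝ] F →L[ℝ] ℝ) (L : F →L[ℝ] F)
    (hT : ∀ a b, T a b = T b a) (hL : ∀ a, T a (L a) = 0) {Ω : Set E} (hΩ : IsOpen Ω) (e : ι → E)
    {U Q : E → F} {g : E → ℝ} (hU : DifferentiableOn ℝ U Ω)
    (hA : ∀ K, IsCompact K → K ⊆ Ω → ∀ j,
      MemLp (fun x => fderiv ℝ U x (e j)) 2 (volume.restrict K))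
    (hQ : ∀ K, IsCompact K → K ⊆ Ω → IntegrableOn Q K)
    (hQL : ∀ x ∈ Ω, T (Q x) (L (U x)) = 0)
    (hg : DifferentiableOn ℝ g Ω)
    (hgU : ∀ x ∈ Ω, ∀ j, fderiv ℝ g x (e j) = T (L (U x)) (fderiv ℝ U x (e j)))
    (hw : ∀ φ : E → F, ContDiff ℝ (⊤ : ℕ∞) φ → HasCompactSupport φ → tsupport φ ⊆ Ω →
      ∫ x, ((∑ j, T (fderiv ℝ U x (e j)) (fderiv ℝ φ x (e j))) + T (Q x) (φ x)) = 0)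
    {χ : E → ℝ} (hχ : ContDiff ℝ (⊤ : ℕ∞) χ) (hχc : HasCompactSupport χ) (hχs : tsupport χ ⊆ Ω)
    (hχ0 : ∀ x, 0 ≤ χ x)
    (hχg : ∀ x ∈ Ω, ∑ j, fderiv ℝ χ x (e j) * fderiv ℝ g x (e j) = 0) :
    ∀ᵐ x, χ x * ∑ j, fderiv ℝ g x (e j) ^ 2 = 0 := by
  have hχd : Differentiable ℝ χ := hχ.differentiable (by simp)
  have hLU : DifferentiableOn ℝ (fun x => L (U x)) Ω := L.differentiable.comp_differentiableOn hU
  have hLUd : ∀ x ∈ Ω, ∀ v, fderiv ℝ (fun y => L (U y)) x v = L (fderiv ℝ U x v) := by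
    intro x hx v
    have h : HasFDerivAt (fun y => L (U y)) (L ∘L fderiv ℝ U x) x :=
      L.hasFDerivAt.comp x (hU.differentiableAt (hΩ.mem_nhds hx)).hasFDerivAt
    rw [h.fderiv]
    rfl
  set φ : E → F := fun x => χ x • (g x • L (U x)) with hφdef
  have hsub : tsupport φ ⊆ tsupport χ := closure_mono fun x hx h => hx (by simp [hφdef, h])
  have hφc : HasCompactSupport φ := hχc.mono' (subset_closure.trans hsub)
  have hφd : Differentiable ℝ φ := by
    intro x
    by_cases hx : x ∈ Ω
    · have hx' := hΩ.mem_nhds hx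
      exact (hχd x).smul ((hg.differentiableAt hx').smul (hLU.differentiableAt hx'))
    · have h0 : φ =ᶠ[𝓝 x] 0 :=
        notMem_tsupport_iff_eventuallyEq.1 fun h => hx (hχs (hsub h))
      exact (differentiableAt_const (0 : F)).congr_of_eventuallyEq h0
  have hgL2 : ∀ K, IsCompact K → K ⊆ Ω → ∀ j,
      MemLp (fun x => fderiv ℝ g x (e j)) 2 (volume.restrict K) := by
    intro K hK hKs j
    obtain ⟨C, hC⟩ := hK.exists_bound_of_continuousOn (hLU.continuousOn.mono hKs)
    refine ((hA K hK hKs j).norm.const_mul (‖T‖ * C)).mono'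
      (aestronglyMeasurable_fderiv_apply _ _ _)
      (ae_restrict_of_forall_mem hK.measurableSet fun x hx => ?_)
    rw [hgU x (hKs hx)]
    refine (T.le_opNorm₂ _ _).trans ?_
    have := hC x hx
    gcongr
  have hφ2 : ∀ j, MemLp (fun x => fderiv ℝ φ x (e j)) 2 volume := by
    intro j
    refine MemLp.of_restrict_tsupport ?_
    have hK : IsCompact (tsupport φ) := hφc
    have hKs := hsub.trans hχs
    refine memLp_fderiv_smul hΩ hK hKs hχd.differentiableOn (hg.smul hLU) ?_
      (memLp_fderiv_smul hΩ hK hKs hg hLU (hgL2 _ hK hKs j) ?_)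
    · have hcont : Continuous fun x => fderiv ℝ χ x (e j) :=
        (hχ.continuous_fderiv (by simp)).clm_apply continuous_const
      exact (hcont.memLp_of_hasCompactSupport (hχc.fderiv_apply ℝ (e j))).restrict _
    · refine (L.comp_memLp' (hA _ hK hKs j)).ae_eq
        (ae_restrict_of_forall_mem hK.measurableSet fun x hx => ?_)
      exact (hLUd x (hKs hx) _).symm
  have hzero := integral_bilin_eq_zero_of_differentiable T hΩ e hA hQ hw hφd hφc
    (hsub.trans hχs) hφ2
  have hpt : ∀ x, (∑ j, T (fderiv ℝ U x (e j)) (fderiv ℝ φ x (e j))) + T (Q x) (φ x)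
      = χ x * ∑ j, fderiv ℝ g x (e j) ^ 2 := by
    intro x
    by_cases hx : x ∈ Ω
    · have hx' := hΩ.mem_nhds hx
      have hd : ∀ v, fderiv ℝ φ x v = χ x • (g x • L (fderiv ℝ U x v) + fderiv ℝ g x v • L (U x))
          + fderiv ℝ χ x v • (g x • L (U x)) := by
        intro v
        have hgx := hg.differentiableAt hx'
        have hLUx := hLU.differentiableAt hx'
        rw [hφdef, fderiv_fun_smul (hχd x) (hgx.fun_smul hLUx), fderiv_fun_smul hgx hLUx,
          ← hLUd x hx]
        rfl
      have hT' : ∀ j, T (fderiv ℝ U x (e j)) (L (U x)) = fderiv ℝ g x (e j) := fun j => by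
        rw [hT, hgU x hx]
      have h1 : ∀ j, T (fderiv ℝ U x (e j)) (fderiv ℝ φ x (e j))
          = χ x * fderiv ℝ g x (e j) ^ 2
            + g x * (fderiv ℝ χ x (e j) * fderiv ℝ g x (e j)) := by
        intro j
        simp only [hd, map_add, map_smul, hL, hT', smul_eq_mul]
        ring
      simp only [h1, Finset.sum_add_distrib, ← Finset.mul_sum, hχg x hx]
      simp [hφdef, hQL x hx]
    · have hxs : x ∉ tsupport χ := fun h => hx (hχs h)
      have h1 : χ x = 0 := image_eq_zero_of_notMem_tsupport hxs
      have h2 : fderiv ℝ φ x = 0 := fderiv_of_notMem_tsupport ℝ fun h => hxs (hsub h)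
      simp [h1, h2, show φ x = 0 by simp [hφdef, h1]]
  simp only [hpt] at hzero
  have hint : Integrable fun x => χ x * ∑ j, fderiv ℝ g x (e j) ^ 2 := by
    obtain ⟨C, hC⟩ := hχc.exists_bound_of_continuous hχ.continuous
    have hK : IsCompact (tsupport χ) := hχc
    have h1 : IntegrableOn (fun x => ∑ j, fderiv ℝ g x (e j) ^ 2) (tsupport χ) :=
      integrable_finsetSum _ fun j _ => (hgL2 _ hK hχs j).integrable_sq
    have h2 : IntegrableOn (fun x => χ x * ∑ j, fderiv ℝ g x (e j) ^ 2) (tsupport χ) :=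
      Integrable.bdd_mul h1 hχ.continuous.aestronglyMeasurable (Eventually.of_forall hC)
    refine (integrableOn_iff_integrable_of_support_subset fun x hx => ?_).1 h2
    by_contra hxs
    exact hx (by simp [image_eq_zero_of_notMem_tsupport hxs])
  exact (integral_eq_zero_iff_of_nonneg (fun x => mul_nonneg (hχ0 x)
    (Finset.sum_nonneg fun j _ => sq_nonneg _)) hint).1 hzero

end ConservationLaw

section RadialCutoff

variable {E : Type*} [NormedAddCommGroup E] [InnerProductSpace ℝ E]

theorem fderiv_apply_self_eq_zero {F : Type*} [NormedAddCommGroup F] [NormedSpace ℝ F] {f : E → F}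
    {x : E} (hf : DifferentiableAt ℝ f x) (h : ∀ r : ℝ, 0 < r → f (r • x) = f x) :
    fderiv ℝ f x x = 0 := by
  have h1 : HasDerivAt (fun t : ℝ => t • x) x 1 := by
    have := (hasDerivAt_id (1 : ℝ)).smul_const x
    rwa [one_smul] at this
  have hf' : HasFDerivAt f (fderiv ℝ f x) ((1 : ℝ) • x) := by
    rw [one_smul]
    exact hf.hasFDerivAt
  have h2 : HasDerivAt (fun t : ℝ => f (t • x)) (fderiv ℝ f x x) 1 := hf'.comp_hasDerivAt 1 h1
  refine h2.unique ((hasDerivAt_const 1 (f x)).congr_of_eventuallyEq ?_)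
  filter_upwards [lt_mem_nhds (zero_lt_one' ℝ)] with t ht using h t ht

variable [FiniteDimensional ℝ E]

/-- Radial cutoff functions exhausting the punctured space. -/
theorem exists_radial_cutoff : ∃ χ : ℕ → E → ℝ,
    (∀ n, ContDiff ℝ (⊤ : ℕ∞) (χ n) ∧ HasCompactSupport (χ n) ∧ tsupport (χ n) ⊆ {x | x ≠ 0} ∧
      (∀ x, 0 ≤ χ n x) ∧ ∀ x, ∃ k : ℝ, ∀ v, fderiv ℝ (χ n) x v = k * inner ℝ x v) ∧
    ∀ x, x ≠ 0 → ∃ n, χ n x ≠ 0 := by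
  have hpos : ∀ n : ℕ, (0 : ℝ) < (n + 2) - (n + 2 : ℝ)⁻¹ := fun n => by
    have h1 : (1 : ℝ) < n + 2 := by linarith [n.cast_nonneg (α := ℝ)]
    linarith [inv_lt_one_of_one_lt₀ h1]
  let ψ : ∀ n : ℕ, ContDiffBump (n + 2 : ℝ) := fun n =>
    ⟨((n + 2) - (n + 2 : ℝ)⁻¹) / 2, (n + 2) - (n + 2 : ℝ)⁻¹, half_pos (hpos n),
      half_lt_self (hpos n)⟩
  have hψ : ∀ n, ContDiff ℝ (⊤ : ℕ∞) (ψ n) := fun n => (ψ n).contDiff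
  have hsupp : ∀ n, tsupport (fun x : E => ψ n (‖x‖ ^ 2))
      ⊆ {x | ‖x‖ ^ 2 ∈ Metric.closedBall (n + 2 : ℝ) ((n + 2) - (n + 2 : ℝ)⁻¹)} := by
    intro n
    refine closure_minimal (fun x hx => ?_) (Metric.isClosed_closedBall.preimage (by fun_prop))
    have : ‖x‖ ^ 2 ∈ Function.support (ψ n) := hx
    rw [(ψ n).support_eq] at this
    exact Metric.ball_subset_closedBall this
  refine ⟨fun n x => ψ n (‖x‖ ^ 2), fun n => ⟨(hψ n).comp (contDiff_norm_sq ℝ), ?_, ?_,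
    fun x => (ψ n).nonneg, fun x => ?_⟩, fun x hx => ?_⟩
  · refine HasCompactSupport.of_support_subset_isCompact
      (isCompact_closedBall (0 : E) (2 * (n + 2))) fun x hx => ?_
    have h1 := hsupp n (subset_closure hx)
    simp only [Set.mem_ofPred_eq, Real.closedBall_eq_Icc, Set.mem_Icc] at h1
    have h2 : (0 : ℝ) < (n + 2 : ℝ)⁻¹ := by positivity
    rw [mem_closedBall_zero_iff]
    nlinarith [norm_nonneg x, n.cast_nonneg (α := ℝ)]
  · intro x hx hx0
    have h1 := hsupp n hx
    simp only [Set.mem_ofPred_eq, Real.closedBall_eq_Icc, Set.mem_Icc, hx0, norm_zero] at h1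
    have h2 : (0 : ℝ) < (n + 2 : ℝ)⁻¹ := by positivity
    linarith [h1.1]
  · refine ⟨deriv (ψ n) (‖x‖ ^ 2) * 2, fun v => ?_⟩
    have h1 := ((hψ n).differentiable (by simp) (‖x‖ ^ 2)).hasDerivAt.comp_hasFDerivAt x
      (hasStrictFDerivAt_norm_sq x).hasFDerivAt
    have h2 : HasFDerivAt (fun y : E => ψ n (‖y‖ ^ 2)) _ x := h1
    rw [h2.fderiv]
    simp [mul_assoc]
  · have ht : 0 < ‖x‖ ^ 2 := by positivity
    obtain ⟨n, hn⟩ := exists_nat_gt (max (‖x‖ ^ 2) (‖x‖ ^ 2)⁻¹)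
    refine ⟨n, ((ψ n).pos_of_mem_ball ?_).ne'⟩
    have h1 : ‖x‖ ^ 2 < n := (le_max_left _ _).trans_lt hn
    have h2 : (‖x‖ ^ 2)⁻¹ < n + 2 := by linarith [(le_max_right (‖x‖ ^ 2) (‖x‖ ^ 2)⁻¹).trans_lt hn]
    have h3 : (n + 2 : ℝ)⁻¹ < ‖x‖ ^ 2 := inv_lt_of_inv_lt₀ ht h2
    have h4 := hpos n
    simp only [ψ, Real.ball_eq_Ioo, Set.mem_Ioo]
    constructor <;> linarith

end RadialCutoff

section UnitaryMaps

variable {m : ℕ}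

/-- The real inner product `Re tr(Aᴴ B)` on complex matrices. -/
noncomputable def reTraceForm (m : ℕ) :
    Matrix (Fin m) (Fin m) ℂ →L[ℝ] Matrix (Fin m) (Fin m) ℂ →L[ℝ] ℝ :=
  (LinearMap.mk₂ ℝ (fun A B : Matrix (Fin m) (Fin m) ℂ => (Aᴴ * B).trace.re)
    (fun A A' B => by simp [Matrix.add_mul]) (fun r A B => by simp)
    (fun A B B' => by simp [Matrix.mul_add]) (fun r A B => by simp)).toContinuousBilinearMap

theorem reTraceForm_apply (A B : Matrix (Fin m) (Fin m) ℂ) :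
    reTraceForm m A B = (Aᴴ * B).trace.re := rfl

/-- Multiplication by the imaginary unit on complex matrices, as a real linear map. -/
noncomputable def matrixMulI (m : ℕ) : Matrix (Fin m) (Fin m) ℂ →L[ℝ] Matrix (Fin m) (Fin m) ℂ :=
  LinearMap.toContinuousLinearMap
    ((Complex.I • LinearMap.id : Matrix (Fin m) (Fin m) ℂ →ₗ[ℂ] _).restrictScalars ℝ)

theorem matrixMulI_apply (A : Matrix (Fin m) (Fin m) ℂ) : matrixMulI m A = Complex.I • A := rfl

theorem reTraceForm_comm (A B : Matrix (Fin m) (Fin m) ℂ) :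
    reTraceForm m A B = reTraceForm m B A := by
  have h : (Aᴴ * B).trace = star (Bᴴ * A).trace := by
    rw [← Matrix.trace_conjTranspose]
    simp
  rw [reTraceForm_apply, reTraceForm_apply, h]
  simp

theorem reTraceForm_matrixMulI (A : Matrix (Fin m) (Fin m) ℂ) :
    reTraceForm m A (matrixMulI m A) = 0 := by
  simp [reTraceForm_apply, matrixMulI_apply, trace_conjTranspose_mul_self_im]

theorem reTraceForm_matrixMulI_left (A B : Matrix (Fin m) (Fin m) ℂ) :
    reTraceForm m (matrixMulI m A) B = (Aᴴ * B).trace.im := by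
  simp [reTraceForm_apply, matrixMulI_apply]

theorem reTraceForm_sum_mul_inv_mul {ι : Type*} [Fintype ι] {V : Matrix (Fin m) (Fin m) ℂ}
    (hV : V ∈ Matrix.unitaryGroup (Fin m) ℂ) {A : ι → Matrix (Fin m) (Fin m) ℂ}
    (hA : ∀ j, (A j)ᴴ * V + Vᴴ * A j = 0) :
    reTraceForm m (∑ j, A j * V⁻¹ * A j) (matrixMulI m V) = 0 := by
  have hinv : V⁻¹ = Vᴴ := Matrix.inv_eq_left_inv (Matrix.mem_unitaryGroup_iff'.1 hV)
  simp only [map_sum, FunLike.coe_sum, Finset.sum_apply]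
  refine Finset.sum_eq_zero fun j _ => ?_
  set B := (A j)ᴴ * V with hB
  have hBstar : Bᴴ = -B := by
    rw [eq_neg_iff_add_eq_zero, add_comm, ← hA j]
    simp [hB]
  have htr : (B * B).trace.im = 0 := by
    refine Complex.conj_eq_iff_im.1 ?_
    change star (B * B).trace = _
    rw [← Matrix.trace_conjTranspose]
    simp [hBstar]
  have heq : (A j * V⁻¹ * A j)ᴴ * V = B * B := by
    simp [hinv, hB, Matrix.mul_assoc]
  rw [reTraceForm_apply, matrixMulI_apply, Matrix.mul_smul, heq]
  simp [htr]

theorem exists_mem_unitaryGroup_mul_mem_specialUnitaryGroup (hm : m ≠ 0) {α : ℂ} (hα : ‖α‖ = 1) :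
    ∃ U₀ ∈ Matrix.unitaryGroup (Fin m) ℂ, ∀ V ∈ Matrix.unitaryGroup (Fin m) ℂ, V.det = α →
      U₀ * V ∈ Matrix.specialUnitaryGroup (Fin m) ℂ := by
  obtain ⟨c, hc⟩ := IsAlgClosed.exists_pow_nat_eq (star α) (Nat.pos_of_ne_zero hm)
  have hc1 : ‖c‖ = 1 := by
    rw [← pow_eq_one_iff_of_nonneg (norm_nonneg c) hm, ← norm_pow, hc, norm_star, hα]
  have hU₀ : c • (1 : Matrix (Fin m) (Fin m) ℂ) ∈ Matrix.unitaryGroup (Fin m) ℂ := by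
    rw [Matrix.mem_unitaryGroup_iff]
    have : c * star c = 1 := by
      change c * (starRingEnd ℂ) c = 1
      rw [Complex.mul_conj, Complex.normSq_eq_norm_sq, hc1]
      simp
    rw [star_smul, star_one, smul_mul_smul_comm, this, one_smul, one_mul]
  refine ⟨_, hU₀, fun V hV hd => Matrix.mem_specialUnitaryGroup_iff.2 ⟨mul_mem hU₀ hV, ?_⟩⟩
  rw [Matrix.det_mul, Matrix.det_smul, Fintype.card_fin, hc, hd, Matrix.det_one, mul_one]
  change (starRingEnd ℂ) α * α = 1
  rw [mul_comm, Complex.mul_conj, Complex.normSq_eq_norm_sq, hα]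
  simp

end UnitaryMaps

theorem sum_apply_smul_single (x : EuclideanSpace ℝ (Fin 3)) :
    ∑ j, x j • EuclideanSpace.single j (1 : ℝ) = x := by
  simpa using (EuclideanSpace.basisFun (Fin 3) ℝ).sum_repr x

/-- A degree-zero homogeneous weakly harmonic map `U : ℝ³\{0} → U(m)` has constant
determinant `α ∈ U(1)`; after multiplication by a constant unitary matrix `U₀` it takes
values in `SU(m)`, and consequently `tr(U* ∂_j U) ≡ 0` for all `j`. -/
theorem homogeneous_harmonic_det_constant {m : ℕ} (hm : 2 ≤ m)
    (U : EuclideanSpace ℝ (Fin 3) → Matrix (Fin m) (Fin m) ℂ)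
    (hUunit : ∀ x, U x ∈ Matrix.unitaryGroup (Fin m) ℂ)
    -- degree-zero homogeneity: U(rk) = U(k) for r > 0
    (hhom : ∀ (r : ℝ), 0 < r → ∀ x : EuclideanSpace ℝ (Fin 3), x ≠ 0 → U (r • x) = U x)
    -- W^{1,2}_loc regularity away from the origin
    (hUdiff : DifferentiableOn ℝ U {x | x ≠ 0})
    (hUL2 : ∀ K : Set (EuclideanSpace ℝ (Fin 3)), IsCompact K → K ⊆ {x | x ≠ 0} →
      IntegrableOn (fun x => ∑ j, ‖empd3 j U x‖ ^ 2) K volume)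
    -- weakly harmonic on ℝ³\{0}: weak form of −ΔU + ∑_j ∂_jU U⁻¹ ∂_jU = 0
    (hweak : ∀ φ : EuclideanSpace ℝ (Fin 3) → Matrix (Fin m) (Fin m) ℂ,
      ContDiff ℝ (⊤ : ℕ∞) φ → HasCompactSupport φ → tsupport φ ⊆ {x | x ≠ 0} →
      ∫ x, ((∑ j, (Matrix.trace ((empd3 j U x)ᴴ * empd3 j φ x)).re)
        + (Matrix.trace ((∑ j, empd3 j U x * (U x)⁻¹ * empd3 j U x)ᴴ * φ x)).re) = 0) :
    ∃ α : ℂ, ‖α‖ = 1 ∧ (∀ x ≠ 0, (U x).det = α) ∧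
      ∃ U₀ ∈ Matrix.unitaryGroup (Fin m) ℂ,
        (∀ x ≠ 0, U₀ * U x ∈ Matrix.specialUnitaryGroup (Fin m) ℂ) ∧
        (∀ j, ∀ x ≠ 0, Matrix.trace ((U x)ᴴ * empd3 j U x) = 0) := by
  set Ω : Set (EuclideanSpace ℝ (Fin 3)) := {x | x ≠ 0} with hΩdef
  have hΩ : IsOpen Ω := isOpen_ne
  have hrank : 2 < Module.rank ℝ (EuclideanSpace ℝ (Fin 3)) := by
    rw [← Module.finrank_eq_rank, finrank_euclideanSpace_fin]
    norm_num
  have hUd : ∀ x ∈ Ω, DifferentiableAt ℝ U x := fun x hx =>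
    hUdiff.differentiableAt (hΩ.mem_nhds hx)
  have hdet1 : ∀ x, ‖(U x).det‖ = 1 := fun x =>
    CStarRing.norm_of_mem_unitary (Matrix.det_of_mem_unitary (hUunit x))
  obtain ⟨g, hgc, hgexp⟩ := exists_real_lift_compl_zero (d := fun x => (U x).det) hrank
    (fun x hx => by
      obtain ⟨D, hD, -⟩ := hasFDerivAt_det_of_mem_unitaryGroup (hUd x hx) (hUunit x)
      exact hD.continuousAt.continuousWithinAt) fun x _ => hdet1 x
  have hgder : ∀ x ∈ Ω, ∃ G : EuclideanSpace ℝ (Fin 3) →L[ℝ] ℝ, HasFDerivAt g G x ∧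
      ∀ v, G v = ((U x)ᴴ * fderiv ℝ U x v).trace.im := by
    intro x hx
    obtain ⟨D, hD, hDv⟩ := hasFDerivAt_det_of_mem_unitaryGroup (hUd x hx) (hUunit x)
    refine ⟨_, hasFDerivAt_of_exp_mul_I_eq (hgc.continuousAt (hΩ.mem_nhds hx))
      (Filter.mem_of_superset (hΩ.mem_nhds hx) hgexp) hD, fun v => ?_⟩
    have h0 : (U x).det ≠ 0 := norm_ne_zero_iff.1 (by rw [hdet1 x]; exact one_ne_zero)
    simp [hDv, h0]
  have hg : DifferentiableOn ℝ g Ω := fun x hx => by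
    obtain ⟨G, hG, -⟩ := hgder x hx
    exact hG.differentiableAt.differentiableWithinAt
  have hgv : ∀ x ∈ Ω, ∀ v, fderiv ℝ g x v = ((U x)ᴴ * fderiv ℝ U x v).trace.im := by
    intro x hx v
    obtain ⟨G, hG, hGv⟩ := hgder x hx
    rw [hG.fderiv, hGv]
  have hgrad : ∀ (x v : EuclideanSpace ℝ (Fin 3)),
      ∑ j, v j * fderiv ℝ g x (EuclideanSpace.single j 1) = fderiv ℝ g x v := by
    intro x v
    conv_rhs => rw [← sum_apply_smul_single v]
    simp
  have hgx : ∀ x ∈ Ω, fderiv ℝ g x x = 0 := by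
    intro x hx
    have h0 : fderiv ℝ U x x = 0 :=
      fderiv_apply_self_eq_zero (hUd x hx) fun r hr => hhom r hr x hx
    rw [hgv x hx, h0]
    simp
  obtain ⟨χ, hχ, hχne⟩ := exists_radial_cutoff (E := EuclideanSpace ℝ (Fin 3))
  have hA : ∀ K, IsCompact K → K ⊆ Ω → ∀ j : Fin 3,
      MemLp (fun x => fderiv ℝ U x (EuclideanSpace.single j 1)) 2 (volume.restrict K) :=
    fun K hK hKs j =>
      memLp_fderiv_apply (e := fun j => EuclideanSpace.single j (1 : ℝ)) (hUL2 K hK hKs) j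
  have hae : ∀ n, ∀ᵐ x, χ n x * ∑ j, fderiv ℝ g x (EuclideanSpace.single j 1) ^ 2 = 0 := by
    intro n
    obtain ⟨h1, h2, h3, h4, h5⟩ := hχ n
    refine ae_mul_sum_sq_eq_zero_of_weak (reTraceForm m) (matrixMulI m) reTraceForm_comm
      reTraceForm_matrixMulI hΩ (fun j => EuclideanSpace.single j (1 : ℝ)) hUdiff hA
      (Q := fun x => ∑ j, empd3 j U x * (U x)⁻¹ * empd3 j U x)
      ?_ ?_ hg ?_ hweak h1 h2 h3 h4 ?_
    · intro K hK hKs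
      have hinv : ∀ x, (U x)⁻¹ = (U x)ᴴ := fun x =>
        Matrix.inv_eq_left_inv (Matrix.mem_unitaryGroup_iff'.1 (hUunit x))
      have hcont : ContinuousOn (fun x => (U x)⁻¹) K := by
        simp only [hinv]
        exact continuous_id.matrix_conjTranspose.comp_continuousOn (hUdiff.continuousOn.mono hKs)
      let := Matrix.frobeniusNormedRing (m := Fin m) (α := ℂ)
      exact integrableOn_sum_mul_mul (R := Matrix (Fin m) (Fin m) ℂ) hK hcont (hA K hK hKs)
    · intro x hx
      exact reTraceForm_sum_mul_inv_mul (hUunit x) fun j =>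
        conjTranspose_mul_fderiv_add_eq_zero (hUd x hx) hUunit _
    · intro x hx j
      exact (hgv x hx _).trans (reTraceForm_matrixMulI_left _ _).symm
    · intro x hx
      obtain ⟨k, hk⟩ := h5 x
      have h6 : ∀ j, inner ℝ x (EuclideanSpace.single j (1 : ℝ)) = x j := fun j => by
        simp [EuclideanSpace.inner_single_right]
      simp only [hk, h6, mul_assoc, ← Finset.mul_sum, hgrad, hgx x hx, mul_zero]
  have hzero : ∀ᵐ x, x ∈ Ω → fderiv ℝ g x = 0 := by
    filter_upwards [ae_all_iff.2 hae] with x hx hxΩ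
    obtain ⟨n, hn⟩ := hχne x hxΩ
    have h1 := (mul_eq_zero.1 (hx n)).resolve_left hn
    rw [Finset.sum_eq_zero_iff_of_nonneg fun j _ => sq_nonneg _] at h1
    ext v
    rw [← hgrad]
    exact Finset.sum_eq_zero fun j hj => by
      rw [(pow_eq_zero_iff two_ne_zero).1 (h1 j hj), mul_zero]
  have hΩc : IsPreconnected Ω :=
    (isConnected_compl_singleton_of_one_lt_rank (lt_trans (by norm_num) hrank) 0).isPreconnected
  obtain ⟨x₀, hx₀⟩ : ∃ x₀ : EuclideanSpace ℝ (Fin 3), x₀ ≠ 0 :=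
    ⟨EuclideanSpace.single 0 1, by simp⟩
  have hconst : ∀ x ∈ Ω, (U x).det = (U x₀).det := fun x hx => by
    rw [← hgexp x hx, ← hgexp x₀ hx₀, eq_of_ae_fderiv_eq_zero hΩ hΩc hg hzero hx hx₀]
  obtain ⟨U₀, hU₀, hspecial⟩ :=
    exists_mem_unitaryGroup_mul_mem_specialUnitaryGroup (m := m) (by omega) (hdet1 x₀)
  refine ⟨(U x₀).det, hdet1 x₀, hconst, U₀, hU₀, fun x hx => hspecial _ (hUunit x) (hconst x hx),
    fun j x hx => ?_⟩
  obtain ⟨D, hD, hDv⟩ := hasFDerivAt_det_of_mem_unitaryGroup (hUd x hx) (hUunit x)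
  have hD0 : D = 0 := hD.unique ((hasFDerivAt_const (U x₀).det x).congr_of_eventuallyEq
    (Filter.mem_of_superset (hΩ.mem_nhds hx) hconst))
  have h1 := hDv (EuclideanSpace.single j 1)
  rw [hD0] at h1
  have h0 : (U x).det ≠ 0 := norm_ne_zero_iff.1 (by rw [hdet1 x]; exact one_ne_zero)
  exact (mul_eq_zero.1 h1.symm).resolve_left h0
end
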